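/- Let μ_∅ be a probability measure on ℕ with finite mean and μ a critical aperiodic probability measure on ℤ₊ belonging to the domain of attraction of a stable law of index α ∈ (1,2]. Denoting by N_0(τ) = k_∅(τ) the number of children of the root, one has sup_{k≥1} | BGW_n^{μ_∅,μ}(N_0 = k) − k μ_∅(k)/Σ_{j≥1} j μ_∅(j) | → 0 as n → ∞, i.e. the law of the root degree under BGW_n^{μ_∅,μ} converges uniformly in k to the size-biased law of μ_∅. -/

import Mathlib

open Filter Set

noncomputable section

/-- A plane tree in Neveu's formalism: a finite set of finite words of positive integers,
containing the root `[]`, closed under prefixes, and such that the children of a vertex `u`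
are `u1, …, u k_u`. -/
structure PlaneTree where
  verts : Finset (List ℕ)
  root_mem : [] ∈ verts
  prefix_closed : ∀ u v : List ℕ, u <+: v → v ∈ verts → u ∈ verts
  labels_pos : ∀ u ∈ verts, ∀ i ∈ u, 1 ≤ i
  children_closed : ∀ (u : List ℕ) (i : ℕ), 1 ≤ i → u ++ [i + 1] ∈ verts → u ++ [i] ∈ verts

namespace PlaneTree

/-- The number of children of the vertex `u` in `τ`. -/
def kc (τ : PlaneTree) (u : List ℕ) : ℕ := Set.ncard {i : ℕ | u ++ [i] ∈ τ.verts}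

/-- The number of vertices of the subtree grafted on `u` (that is, `u` and its descendants). -/
def subtreeSize (τ : PlaneTree) (u : List ℕ) : ℕ :=
  Set.ncard {v : List ℕ | v ∈ τ.verts ∧ u <+: v}

/-- `M(τ)`: the size of the largest subtree grafted on a child of the root of `τ`. -/
def maxSub (τ : PlaneTree) : ℕ := (Finset.Icc 1 (τ.kc [])).sup fun i => τ.subtreeSize [i]

end PlaneTree

/-- The Bienaymé–Galton–Watson weight `BGW^μ(τ) = ∏_{u ∈ τ} μ(k_u)` of a plane tree. -/
def bgwW (μ : ℕ → ℝ) (τ : PlaneTree) : ℝ := ∏ u ∈ τ.verts, μ (τ.kc u)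

/-- The modified Bienaymé–Galton–Watson weight of a plane tree: the root reproduces according
to `μ0` and the other vertices according to `μ`. -/
def bgwModW (μ0 μ : ℕ → ℝ) (τ : PlaneTree) : ℝ :=
  μ0 (τ.kc []) * ∏ u ∈ τ.verts.erase [], μ (τ.kc u)

/-- The total mass `BGW^{μ0,μ}(T_n)` given by the modified Bienaymé–Galton–Watson measure to
plane trees with `n` vertices. -/
def bgwModMass (μ0 μ : ℕ → ℝ) (n : ℕ) : ℝ :=
  ∑ᶠ τ ∈ {τ : PlaneTree | τ.verts.card = n}, bgwModW μ0 μ τ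

/-- `μ` belongs to the domain of attraction of a stable law of index `α ∈ (1,2]`: either
`α = 2` and `μ` has finite variance, or `α < 2` and the tail `μ([n,∞))` equals `g(n) n^{-α}`
for a slowly varying function `g`. -/
def DomAttr (μ : ℕ → ℝ) (α : ℝ) : Prop :=
  (α = 2 ∧ Summable fun k : ℕ => (k : ℝ) ^ 2 * μ k) ∨
  (α < 2 ∧ ∃ g : ℝ → ℝ, (∀ x : ℝ, 0 < x → 0 < g x) ∧
    (∀ c : ℝ, 0 < c → Tendsto (fun x => g (c * x) / g x) atTop (nhds 1)) ∧
    ∀ n : ℕ, 1 ≤ n → (∑' k : ℕ, {m : ℕ | n ≤ m}.indicator μ k) = g n * (n : ℝ) ^ (-α))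


namespace PlaneTree

theorem ext' {τ σ : PlaneTree} (h : τ.verts = σ.verts) : τ = σ := by
  cases τ; cases σ; simp_all

theorem nat_set_eq {S : Set ℕ} (hf : S.Finite) (hp : ∀ i ∈ S, 1 ≤ i)
    (hd : ∀ i, 1 ≤ i → i + 1 ∈ S → i ∈ S) : ∃ N, S = Set.Icc 1 N := by
  have hdown : ∀ d i, 1 ≤ i → i + d ∈ S → i ∈ S := by
    intro d
    induction d with
    | zero => intro i _ h; exact h
    | succ d ih => intro i hi h; exact ih i hi (hd _ (by omega) h)
  by_cases hne : S.Nonempty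
  · obtain ⟨N, hN, hmax⟩ := hf.exists_maximal hne
    refine ⟨N, ?_⟩
    ext i
    constructor
    · intro hi
      refine ⟨hp i hi, ?_⟩
      rcases le_total i N with h | h
      · exact h
      · exact hmax hi h
    · rintro ⟨h1, h2⟩
      exact hdown (N - i) i h1 (by rwa [Nat.add_sub_cancel' h2])
  · refine ⟨0, ?_⟩
    rw [Set.not_nonempty_iff_eq_empty] at hne
    rw [hne]; ext i; simp

theorem kc_eq_of {τ : PlaneTree} {u : List ℕ} {N : ℕ}
    (h : ∀ i, u ++ [i] ∈ τ.verts ↔ 1 ≤ i ∧ i ≤ N) : τ.kc u = N := by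
  unfold kc
  have : {i : ℕ | u ++ [i] ∈ τ.verts} = ((Finset.Icc 1 N : Finset ℕ) : Set ℕ) := by
    ext i; simp [h]
  rw [this, Set.ncard_coe_finset]; simp

theorem mem_child (τ : PlaneTree) (u : List ℕ) (i : ℕ) :
    u ++ [i] ∈ τ.verts ↔ 1 ≤ i ∧ i ≤ τ.kc u := by
  have hf : {i : ℕ | u ++ [i] ∈ τ.verts}.Finite := by
    apply Set.Finite.preimage (f := fun i => u ++ [i]) _ τ.verts.finite_toSet
    intro a _ b _ h
    simpa using h
  obtain ⟨N, hN⟩ := nat_set_eq hf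
    (fun i hi => τ.labels_pos _ hi i (by simp)) (fun i hi h => τ.children_closed u i hi h)
  have h : ∀ i, u ++ [i] ∈ τ.verts ↔ 1 ≤ i ∧ i ≤ N := fun i => by
    have : i ∈ {i : ℕ | u ++ [i] ∈ τ.verts} ↔ i ∈ Set.Icc 1 N := by rw [hN]
    simpa using this
  rw [kc_eq_of h]; exact h i

theorem mem_root_child (τ : PlaneTree) (i : ℕ) :
    [i] ∈ τ.verts ↔ 1 ≤ i ∧ i ≤ τ.kc [] := by
  simpa using τ.mem_child [] i

theorem mem_cons_le (τ : PlaneTree) {i : ℕ} {v : List ℕ} (h : i :: v ∈ τ.verts) :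
    1 ≤ i ∧ i ≤ τ.kc [] := by
  rw [← mem_root_child]
  exact τ.prefix_closed [i] (i :: v) (by simp) h

theorem card_pos (τ : PlaneTree) : 1 ≤ τ.verts.card :=
  Finset.card_pos.mpr ⟨_, τ.root_mem⟩

theorem kc_lt_card (τ : PlaneTree) : τ.kc [] < τ.verts.card := by
  have h : (Finset.Icc 1 (τ.kc [])).image (fun i => [i]) ⊆ τ.verts.erase [] := by
    intro v hv
    simp only [Finset.mem_image, Finset.mem_Icc] at hv
    obtain ⟨i, hi, rfl⟩ := hv
    simp [mem_root_child, hi]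
  have h2 := Finset.card_le_card h
  rw [Finset.card_image_of_injective _ (fun a b h => by simpa using h),
    Finset.card_erase_of_mem τ.root_mem] at h2
  have := τ.card_pos
  simp at h2
  omega

/-- The one-vertex tree. -/
def leaf : PlaneTree where
  verts := {[]}
  root_mem := by simp
  prefix_closed := by
    intro u v h hv
    simp at hv; subst hv; simpa using h
  labels_pos := by simp
  children_closed := by intro u i _ h; simp at h

/-- Graft `σ` as a new last child of the root of `ρ`. -/
def join (ρ σ : PlaneTree) : PlaneTree where
  verts := ρ.verts ∪ σ.verts.image (List.cons (ρ.kc [] + 1))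
  root_mem := by simp [ρ.root_mem]
  prefix_closed := by
    intro u v h hv
    simp only [Finset.mem_union, Finset.mem_image] at hv ⊢
    rcases hv with hv | ⟨w, hw, rfl⟩
    · exact Or.inl (ρ.prefix_closed u v h hv)
    · cases u with
      | nil => exact Or.inl ρ.root_mem
      | cons a u =>
        rw [List.cons_prefix_cons] at h
        obtain ⟨rfl, h⟩ := h
        exact Or.inr ⟨u, σ.prefix_closed u w h hw, rfl⟩
  labels_pos := by
    intro u hu i hi
    simp only [Finset.mem_union, Finset.mem_image] at hu
    rcases hu with hu | ⟨w, hw, rfl⟩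
    · exact ρ.labels_pos u hu i hi
    · simp at hi
      rcases hi with rfl | hi
      · omega
      · exact σ.labels_pos w hw i hi
  children_closed := by
    intro u i hi h
    simp only [Finset.mem_union, Finset.mem_image] at h ⊢
    rcases h with h | ⟨w, hw, h⟩
    · exact Or.inl (ρ.children_closed u i hi h)
    · cases u with
      | nil =>
        simp at h
        left
        simp [mem_root_child]
        omega
      | cons a u =>
        simp at h
        obtain ⟨rfl, rfl⟩ := h
        exact Or.inr ⟨u ++ [i], σ.children_closed u i hi hw, by simp⟩

theorem mem_join (ρ σ : PlaneTree) (v : List ℕ) : v ∈ (join ρ σ).verts ↔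
    v ∈ ρ.verts ∨ ∃ w ∈ σ.verts, (ρ.kc [] + 1) :: w = v := by
  simp [join]

theorem mem_join_new (ρ σ : PlaneTree) (v : List ℕ) :
    (ρ.kc [] + 1) :: v ∈ (join ρ σ).verts ↔ v ∈ σ.verts := by
  rw [mem_join]
  constructor
  · rintro (h | ⟨w, hw, h⟩)
    · have := ρ.mem_cons_le h; omega
    · simp at h; rwa [← h]
  · intro h; exact Or.inr ⟨v, h, rfl⟩

theorem disj_join (ρ σ : PlaneTree) :
    Disjoint ρ.verts (σ.verts.image (List.cons (ρ.kc [] + 1))) := by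
  rw [Finset.disjoint_left]
  intro v hv hv'
  simp only [Finset.mem_image] at hv'
  obtain ⟨w, _, rfl⟩ := hv'
  have := ρ.mem_cons_le hv; omega

theorem card_join (ρ σ : PlaneTree) :
    (join ρ σ).verts.card = ρ.verts.card + σ.verts.card := by
  change (ρ.verts ∪ _).card = _
  rw [Finset.card_union_of_disjoint (disj_join ρ σ),
    Finset.card_image_of_injective _ (List.cons_injective)]

theorem kc_join_root (ρ σ : PlaneTree) : (join ρ σ).kc [] = ρ.kc [] + 1 := by
  apply kc_eq_of
  intro i
  rw [List.nil_append, mem_join, mem_root_child]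
  constructor
  · rintro (h | ⟨w, hw, h⟩)
    · omega
    · simp at h; omega
  · intro h
    by_cases h' : i ≤ ρ.kc []
    · left; omega
    · right; exact ⟨[], σ.root_mem, by simp; omega⟩

theorem kc_join_new (ρ σ : PlaneTree) (v : List ℕ) :
    (join ρ σ).kc ((ρ.kc [] + 1) :: v) = σ.kc v := by
  apply kc_eq_of
  intro i
  rw [List.cons_append, mem_join_new, mem_child]

theorem kc_join_old (ρ σ : PlaneTree) (v : List ℕ) (hv : v ∈ ρ.verts) (hv0 : v ≠ []) :
    (join ρ σ).kc v = ρ.kc v := by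
  apply kc_eq_of
  intro i
  rw [mem_join, ← mem_child]
  constructor
  · rintro (h | ⟨w, hw, h⟩)
    · exact h
    · cases v with
      | nil => exact absurd rfl hv0
      | cons a v =>
        simp at h
        have := ρ.mem_cons_le hv; omega
  · exact Or.inl

/-- Product of weights over non-root vertices. -/
def nrW (μ : ℕ → ℝ) (τ : PlaneTree) : ℝ := ∏ u ∈ τ.verts.erase [], μ (τ.kc u)

theorem nrW_join (μ : ℕ → ℝ) (ρ σ : PlaneTree) :
    nrW μ (join ρ σ) = nrW μ ρ * (μ (σ.kc []) * nrW μ σ) := by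
  unfold nrW
  rw [Finset.mul_prod_erase σ.verts (fun u => μ (σ.kc u)) σ.root_mem]
  have h : (join ρ σ).verts.erase [] =
      ρ.verts.erase [] ∪ σ.verts.image (List.cons (ρ.kc [] + 1)) := by
    ext v
    simp only [Finset.mem_erase, mem_join, Finset.mem_union, Finset.mem_image]
    constructor
    · rintro ⟨h, h1 | h1⟩
      · exact Or.inl ⟨h, h1⟩
      · exact Or.inr h1
    · rintro (h | ⟨w, hw, rfl⟩)
      · exact ⟨h.1, Or.inl h.2⟩
      · exact ⟨by simp, Or.inr ⟨w, hw, rfl⟩⟩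
  rw [h, Finset.prod_union, Finset.prod_image]
  · congr 1
    · apply Finset.prod_congr rfl
      intro v hv
      rw [Finset.mem_erase] at hv
      rw [kc_join_old ρ σ v hv.2 hv.1]
    · apply Finset.prod_congr rfl
      intro v hv
      rw [kc_join_new]
  · intro a _ b _ h; simpa using h
  · exact Finset.disjoint_of_subset_left (Finset.erase_subset _ _) (disj_join ρ σ)

theorem join_inj {ρ σ ρ' σ' : PlaneTree} (h : join ρ σ = join ρ' σ') : ρ = ρ' ∧ σ = σ' := by
  have hk : ρ.kc [] = ρ'.kc [] := by
    have := congrArg (fun τ => kc τ []) h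
    simpa [kc_join_root] using this
  have hσ : σ = σ' := by
    apply ext'
    ext v
    rw [← mem_join_new ρ σ, h, hk, mem_join_new]
  refine ⟨ext' ?_, hσ⟩
  have hd := disj_join ρ σ
  have hd' := disj_join ρ' σ'
  have hv : ρ.verts ∪ σ.verts.image (List.cons (ρ.kc [] + 1)) =
    ρ'.verts ∪ σ'.verts.image (List.cons (ρ'.kc [] + 1)) := congrArg verts h
  rw [hk, hσ] at hv
  rw [hk, hσ] at hd
  rw [← Finset.union_sdiff_cancel_right hd, hv, Finset.union_sdiff_cancel_right hd']

theorem eq_leaf_of_kc {τ : PlaneTree} (h : τ.kc [] = 0) : τ = leaf := by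
  apply ext'
  ext v
  simp only [leaf, Finset.mem_singleton]
  cases v with
  | nil => simp [τ.root_mem]
  | cons a v =>
    simp
    intro hv
    have := τ.mem_cons_le hv; omega

/-- All trees with positive root degree are obtained by grafting. -/
theorem exists_join {τ : PlaneTree} {k : ℕ} (h : τ.kc [] = k + 1) :
    ∃ ρ σ : PlaneTree, ρ.kc [] = k ∧ join ρ σ = τ := by
  classical
  let σ : PlaneTree :=
    { verts := τ.verts.preimage (List.cons (k + 1)) List.cons_injective.injOn
      root_mem := by
        simp [mem_root_child]; omega
      prefix_closed := by
        intro u v huv hv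
        simp only [Finset.mem_preimage] at hv ⊢
        exact τ.prefix_closed _ _ (by simpa using huv) hv
      labels_pos := by
        intro u hu i hi
        simp only [Finset.mem_preimage] at hu
        exact τ.labels_pos _ hu i (by simp [hi])
      children_closed := by
        intro u i hi hu
        simp only [Finset.mem_preimage] at hu ⊢
        exact τ.children_closed ((k + 1) :: u) i hi hu }
  let ρ : PlaneTree :=
    { verts := τ.verts.filter (fun v => ∀ w, v ≠ (k + 1) :: w)
      root_mem := by simp [τ.root_mem]
      prefix_closed := by
        intro u v huv hv
        simp only [Finset.mem_filter] at hv ⊢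
        refine ⟨τ.prefix_closed _ _ huv hv.1, ?_⟩
        rintro w rfl
        obtain ⟨t, rfl⟩ := huv
        exact hv.2 (w ++ t) (by simp)
      labels_pos := by
        intro u hu i hi
        simp only [Finset.mem_filter] at hu
        exact τ.labels_pos _ hu.1 i hi
      children_closed := by
        intro u i hi hu
        simp only [Finset.mem_filter] at hu ⊢
        refine ⟨τ.children_closed u i hi hu.1, ?_⟩
        intro w hw
        cases u with
        | nil =>
          simp at hw
          have := τ.mem_cons_le (v := []) (by simpa using hu.1)
          omega
        | cons a u =>
          simp at hw
          exact hu.2 (u ++ [i + 1]) (by simp [hw.1]) }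
  have hρ : ρ.kc [] = k := by
    apply kc_eq_of
    intro i
    simp only [ρ, List.nil_append, Finset.mem_filter, mem_root_child, h]
    constructor
    · rintro ⟨h1, h2⟩
      have := h2 []
      simp at this
      omega
    · intro h1
      refine ⟨by omega, ?_⟩
      intro w hw
      simp at hw; omega
  refine ⟨ρ, σ, hρ, ext' ?_⟩
  ext v
  rw [mem_join, hρ]
  simp only [ρ, σ, Finset.mem_filter, Finset.mem_preimage]
  constructor
  · rintro (h | ⟨w, hw, rfl⟩)
    · exact h.1
    · exact hw
  · intro hv
    by_cases hw : ∃ w, v = (k + 1) :: w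
    · obtain ⟨w, rfl⟩ := hw
      exact Or.inr ⟨w, hv, rfl⟩
    · exact Or.inl ⟨hv, not_exists.mp hw⟩

theorem finite_lt (n : ℕ) : {τ : PlaneTree | τ.verts.card < n}.Finite := by
  induction n with
  | zero => simp
  | succ n ih =>
    apply ((Set.finite_singleton leaf).union (Set.Finite.image2 join ih ih)).subset
    intro τ hτ
    simp only [Set.mem_ofPred_eq] at hτ
    rcases Nat.eq_zero_or_pos (τ.kc []) with h | h
    · left; exact eq_leaf_of_kc h
    · right
      obtain ⟨ρ, σ, -, rfl⟩ := exists_join (τ := τ) (k := τ.kc [] - 1) (by omega)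
      rw [card_join] at hτ
      have h1 := ρ.card_pos
      have h2 := σ.card_pos
      exact ⟨ρ, by simp; omega, σ, by simp; omega, rfl⟩

theorem finite_T (n : ℕ) : {τ : PlaneTree | τ.verts.card = n}.Finite :=
  (finite_lt (n + 1)).subset (fun τ h => by simp at h ⊢; omega)

theorem finite_Tk (n k : ℕ) : {τ : PlaneTree | τ.verts.card = n ∧ τ.kc [] = k}.Finite :=
  (finite_T n).subset (fun _ h => h.1)

/-- Trees with `n` vertices and root degree `k`. -/
def Tk (n k : ℕ) : Finset PlaneTree := (finite_Tk n k).toFinset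

/-- Trees with `n` vertices. -/
def T (n : ℕ) : Finset PlaneTree := (finite_T n).toFinset

theorem mem_Tk {n k : ℕ} {τ : PlaneTree} : τ ∈ Tk n k ↔ τ.verts.card = n ∧ τ.kc [] = k := by
  simp [Tk]

theorem mem_T {n : ℕ} {τ : PlaneTree} : τ ∈ T n ↔ τ.verts.card = n := by
  simp [T]

/-- Mass of non-root weights of trees with `n` vertices and root degree `k`. -/
def A (μ : ℕ → ℝ) (k n : ℕ) : ℝ := ∑ τ ∈ Tk n k, nrW μ τ

/-- Mass of trees with `n` vertices. -/
def W (μ : ℕ → ℝ) (n : ℕ) : ℝ := ∑ τ ∈ T n, μ (τ.kc []) * nrW μ τ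

theorem sum_T_eq (ν μ : ℕ → ℝ) (n : ℕ) :
    ∑ τ ∈ T n, ν (τ.kc []) * nrW μ τ = ∑ k ∈ Finset.range n, ν k * A μ k n := by
  classical
  rw [← Finset.sum_fiberwise_of_maps_to (s := T n) (t := Finset.range n) (g := fun τ => τ.kc [])]
  · apply Finset.sum_congr rfl
    intro k _
    unfold A
    rw [Finset.mul_sum]
    have : (T n).filter (fun τ => τ.kc [] = k) = Tk n k := by
      ext τ; simp [mem_T, mem_Tk]
    rw [this]
    apply Finset.sum_congr rfl
    intro τ hτ
    rw [(mem_Tk.mp hτ).2]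
  · intro τ hτ
    rw [mem_T] at hτ
    rw [Finset.mem_range, ← hτ]; exact τ.kc_lt_card

theorem A_succ (μ : ℕ → ℝ) (k n : ℕ) :
    A μ (k + 1) n = ∑ p ∈ Finset.HasAntidiagonal.antidiagonal n, A μ k p.1 * W μ p.2 := by
  classical
  unfold A W
  simp_rw [Finset.sum_mul_sum, ← Finset.sum_product']
  rw [Finset.sum_sigma']
  symm
  apply Finset.sum_bij (fun (x : (_ : ℕ × ℕ) × (PlaneTree × PlaneTree)) _ => join x.2.1 x.2.2)
  · rintro ⟨p, ρ, σ⟩ h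
    simp only [Finset.mem_sigma, Finset.HasAntidiagonal.mem_antidiagonal, Finset.mem_product, mem_Tk, mem_T] at h
    rw [mem_Tk, card_join, kc_join_root]
    dsimp only
    omega
  · rintro ⟨⟨p1, p2⟩, ρ, σ⟩ h ⟨⟨q1, q2⟩, ρ', σ'⟩ h' heq
    simp only [Finset.mem_sigma, Finset.HasAntidiagonal.mem_antidiagonal, Finset.mem_product, mem_Tk, mem_T] at h h'
    obtain ⟨rfl, rfl⟩ := join_inj heq
    obtain ⟨_, ⟨rfl, _⟩, rfl⟩ := h
    obtain ⟨_, ⟨rfl, _⟩, rfl⟩ := h'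
    rfl
  · intro τ hτ
    rw [mem_Tk] at hτ
    obtain ⟨ρ, σ, hk, rfl⟩ := exists_join hτ.2
    rw [card_join] at hτ
    refine ⟨⟨(ρ.verts.card, σ.verts.card), ρ, σ⟩, ?_, rfl⟩
    simp only [Finset.mem_sigma, Finset.HasAntidiagonal.mem_antidiagonal, Finset.mem_product, mem_Tk, mem_T]
    simp [hτ.1, hk]
  · rintro ⟨p, ρ, σ⟩ h
    rw [nrW_join]

theorem A_zero (μ : ℕ → ℝ) (n : ℕ) : A μ 0 n = if n = 1 then 1 else 0 := by
  have hleaf : leaf.kc [] = 0 := by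
    apply kc_eq_of; intro i; simp [leaf]; omega
  unfold A
  split_ifs with h
  · have : Tk n 0 = {leaf} := by
      ext τ
      rw [mem_Tk, Finset.mem_singleton]
      constructor
      · intro h; exact eq_leaf_of_kc h.2
      · rintro rfl; exact ⟨by simp [leaf, h], hleaf⟩
    rw [this]; simp [nrW, leaf]
  · apply Finset.sum_eq_zero
    intro τ hτ
    rw [mem_Tk] at hτ
    have := eq_leaf_of_kc hτ.2
    subst this
    simp [leaf] at hτ
    omega

open PowerSeries in
theorem A_series (μ : ℕ → ℝ) (k : ℕ) :
    PowerSeries.mk (A μ k) = X * (PowerSeries.mk (W μ)) ^ k := by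
  induction k with
  | zero =>
    ext n; simp [A_zero, coeff_X]
  | succ k ih =>
    rw [pow_succ, ← mul_assoc, ← ih]
    ext n
    rw [coeff_mul]
    simp [A_succ]

/-- Forest masses. -/
def F (μ : ℕ → ℝ) (k m : ℕ) : ℝ := PowerSeries.coeff m ((PowerSeries.mk (W μ)) ^ k)

theorem A_eq_F (μ : ℕ → ℝ) (k m : ℕ) : A μ k (m + 1) = F μ k m := by
  have := congrArg (PowerSeries.coeff (m + 1)) (A_series μ k)
  rw [PowerSeries.coeff_mk, PowerSeries.coeff_succ_X_mul] at this
  exact this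

theorem W_zero (μ : ℕ → ℝ) : W μ 0 = 0 := by
  unfold W; rw [sum_T_eq]; simp

theorem W_succ (μ : ℕ → ℝ) (m : ℕ) : W μ (m + 1) = ∑ j ∈ Finset.range (m + 1), μ j * F μ j m := by
  unfold W; rw [sum_T_eq]; simp [A_eq_F]

theorem F_eq_zero (μ : ℕ → ℝ) {k m : ℕ} (h : m < k) : F μ k m = 0 := by
  have hX : PowerSeries.X ∣ PowerSeries.mk (W μ) := by
    rw [PowerSeries.X_dvd_iff]; simp [W_zero]
  exact PowerSeries.X_pow_dvd_iff.mp (pow_dvd_pow_of_dvd hX k) m h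

theorem F_zero_left (μ : ℕ → ℝ) (m : ℕ) : F μ 0 m = if m = 0 then 1 else 0 := by
  simp [F, PowerSeries.coeff_one]

theorem W_succ' (μ : ℕ → ℝ) {m M : ℕ} (h : m ≤ M) :
    W μ (m + 1) = ∑ j ∈ Finset.range (M + 1), μ j * F μ j m := by
  rw [W_succ]
  apply Finset.sum_subset
  · intro x; simp; omega
  · intro x _ hx
    simp at hx
    rw [F_eq_zero μ (by omega), mul_zero]

theorem snd_le_antid {m : ℕ} {p : ℕ × ℕ} (hp : p ∈ Finset.HasAntidiagonal.antidiagonal m) :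
    p.2 ≤ m := by
  rw [Finset.HasAntidiagonal.mem_antidiagonal] at hp; omega

theorem F_succ (μ : ℕ → ℝ) (k m : ℕ) :
    F μ (k + 1) (m + 1) = ∑ j ∈ Finset.range (m + 1), μ j * F μ (k + j) m := by
  have h1 : F μ (k + 1) (m + 1) =
      ∑ p ∈ Finset.HasAntidiagonal.antidiagonal m, F μ k p.1 * W μ (p.2 + 1) := by
    unfold F
    rw [pow_succ, PowerSeries.coeff_mul, Finset.Nat.antidiagonal_succ']
    simp [W_zero]
  rw [h1]
  have h2 : ∀ p ∈ Finset.HasAntidiagonal.antidiagonal m, F μ k p.1 * W μ (p.2 + 1) =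
      ∑ j ∈ Finset.range (m + 1), μ j * (F μ k p.1 * F μ j p.2) := by
    intro p hp
    rw [W_succ' μ (snd_le_antid hp), Finset.mul_sum]
    apply Finset.sum_congr rfl; intros; ring
  rw [Finset.sum_congr rfl h2, Finset.sum_comm]
  apply Finset.sum_congr rfl
  intro j _
  rw [← Finset.mul_sum]
  congr 1
  unfold F
  rw [pow_add, PowerSeries.coeff_mul]

/-- Law of sums of `m` iid variables. -/
def pw (μ : ℕ → ℝ) (m l : ℕ) : ℝ := PowerSeries.coeff l ((PowerSeries.mk μ) ^ m)

theorem pw_succ (μ : ℕ → ℝ) (m l : ℕ) :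
    pw μ (m + 1) l = ∑ p ∈ Finset.HasAntidiagonal.antidiagonal l, μ p.1 * pw μ m p.2 := by
  unfold pw
  rw [pow_succ', PowerSeries.coeff_mul]
  simp

theorem pw_exch (μ : ℕ → ℝ) (m l : ℕ) :
    (m + 1 : ℝ) * ∑ p ∈ Finset.HasAntidiagonal.antidiagonal l, (p.1 : ℝ) * μ p.1 * pw μ m p.2 =
      l * pw μ (m + 1) l := by
  have h : PowerSeries.X * PowerSeries.derivative ℝ ((PowerSeries.mk μ) ^ (m + 1)) =
      ((m + 1 : ℕ) : PowerSeries ℝ) * ((PowerSeries.X * PowerSeries.derivative ℝ (PowerSeries.mk μ)) *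
        (PowerSeries.mk μ) ^ m) := by
    rw [Derivation.leibniz_pow]
    simp
    ring
  have hc : ∀ (f : PowerSeries ℝ) (n : ℕ),
      PowerSeries.coeff n (PowerSeries.X * PowerSeries.derivative ℝ f) =
        n * PowerSeries.coeff n f := by
    intro f n
    cases n with
    | zero => simp
    | succ n =>
      rw [PowerSeries.coeff_succ_X_mul, PowerSeries.coeff_derivative]
      push_cast; ring
  have h3 := congrArg (PowerSeries.coeff l) h
  rw [hc, ← nsmul_eq_mul ((m + 1 : ℕ)) (_ : PowerSeries ℝ), map_nsmul, PowerSeries.coeff_mul] at h3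
  simp only [hc, PowerSeries.coeff_mk, nsmul_eq_mul] at h3
  unfold pw
  rw [h3]
  push_cast
  rfl

/-- Kemperman's formula. -/
theorem kemperman (μ : ℕ → ℝ) (m : ℕ) : ∀ k, k ≤ m + 1 →
    (m + 1 : ℝ) * F μ k (m + 1) = k * pw μ (m + 1) (m + 1 - k) := by
  induction m with
  | zero =>
    intro k hk
    interval_cases k
    · simp [F_zero_left]
    · rw [F_succ]; simp [F_zero_left, pw]
  | succ m ih =>
    intro k hk
    cases k with
    | zero => simp [F_zero_left]
    | succ k =>
      rw [F_succ]
      have e1 : ∑ j ∈ Finset.range (m + 1 + 1), μ j * F μ (k + j) (m + 1) =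
          ∑ j ∈ Finset.range (m + 1 - k + 1), μ j * F μ (k + j) (m + 1) := by
        symm
        apply Finset.sum_subset
        · intro x; simp; omega
        · intro x _ hx
          simp at hx
          rw [F_eq_zero μ (by omega), mul_zero]
      have e2 : (m + 1 : ℝ) * ∑ j ∈ Finset.range (m + 1 - k + 1), μ j * F μ (k + j) (m + 1) =
          ∑ p ∈ Finset.HasAntidiagonal.antidiagonal (m + 1 - k),
            (k * (μ p.1 * pw μ (m + 1) p.2) + (p.1 : ℝ) * μ p.1 * pw μ (m + 1) p.2) := by
        rw [Finset.Nat.sum_antidiagonal_eq_sum_range_succ_mk, Finset.mul_sum]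
        apply Finset.sum_congr rfl
        intro j hj
        simp at hj
        have := ih (k + j) (by omega)
        rw [show m + 1 - (k + j) = m + 1 - k - j by omega] at this
        push_cast at this
        simp only
        linear_combination μ j * this
      rw [Finset.sum_add_distrib, ← Finset.mul_sum, ← pw_succ] at e2
      have e3 := pw_exch μ (m + 1) (m + 1 - k)
      rw [Nat.cast_sub (by omega)] at e3
      rw [e1, show m + 1 + 1 - (k + 1) = m + 1 - k by omega]
      have hm : (m + 1 : ℝ) ≠ 0 := by positivity
      apply mul_left_cancel₀ hm
      push_cast at e3 ⊢
      linear_combination ((m:ℝ) + 1 + 1) * e2 + e3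

theorem finsum_Tk (μ0 μ : ℕ → ℝ) (n k : ℕ) :
    (∑ᶠ τ ∈ {τ : PlaneTree | τ.verts.card = n ∧ τ.kc [] = k}, bgwModW μ0 μ τ) =
      μ0 k * A μ k n := by
  rw [finsum_mem_eq_finite_toFinset_sum _ (finite_Tk n k)]
  unfold A
  rw [Finset.mul_sum]
  apply Finset.sum_congr rfl
  intro τ hτ
  have hτ' : τ ∈ Tk n k := hτ
  rw [← (mem_Tk.mp hτ').2]
  rfl

theorem mass_eq (μ0 μ : ℕ → ℝ) (n : ℕ) :
    bgwModMass μ0 μ n = ∑ k ∈ Finset.range n, μ0 k * A μ k n := by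
  unfold bgwModMass
  rw [finsum_mem_eq_finite_toFinset_sum _ (finite_T n), ← sum_T_eq]
  rfl

/-- `P(S_m = -k)` for the random walk with steps `ξ - 1`. -/
def q (μ : ℕ → ℝ) (m k : ℕ) : ℝ := if k ≤ m then pw μ m (m - k) else 0

theorem A_eq_q (μ : ℕ → ℝ) (m k : ℕ) :
    (m + 1 : ℝ) * A μ k (m + 1 + 1) = k * q μ (m + 1) k := by
  rw [A_eq_F]
  unfold q
  split_ifs with h
  · exact kemperman μ m k h
  · rw [F_eq_zero μ (by omega)]; simp

end PlaneTree

namespace PlaneTree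

/-- Generating function of `μ` on the unit circle. -/
def psi (μ : ℕ → ℝ) (t : ℝ) : ℂ := ∑' k : ℕ, (μ k : ℂ) * Complex.exp (t * Complex.I) ^ k

/-- Characteristic function of the step `ξ - 1`. -/
def phi (μ : ℕ → ℝ) (t : ℝ) : ℂ := Complex.exp (-(t * Complex.I)) * psi μ t

theorem norm_e (t : ℝ) : ‖Complex.exp (t * Complex.I)‖ = 1 := Complex.norm_exp_ofReal_mul_I t

theorem summable_norm_psi {μ : ℕ → ℝ} (hμ : Summable μ) (h0 : ∀ k, 0 ≤ μ k) (t : ℝ) :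
    Summable fun k : ℕ => ‖(μ k : ℂ) * Complex.exp (t * Complex.I) ^ k‖ := by
  simpa [norm_e, abs_of_nonneg, h0] using hμ

theorem psi_pow {μ : ℕ → ℝ} (hμ : Summable μ) (h0 : ∀ k, 0 ≤ μ k) (t : ℝ) (m : ℕ) :
    (Summable fun l : ℕ => ‖(pw μ m l : ℂ) * Complex.exp (t * Complex.I) ^ l‖) ∧
      ∑' l : ℕ, (pw μ m l : ℂ) * Complex.exp (t * Complex.I) ^ l = psi μ t ^ m := by
  induction m with
  | zero =>
    have h : ∀ l : ℕ, l ≠ 0 → (pw μ 0 l : ℂ) * Complex.exp (t * Complex.I) ^ l = 0 := by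
      intro l hl; simp [pw, PowerSeries.coeff_one, hl]
    constructor
    · apply summable_of_ne_finset_zero (s := {0})
      intro l hl
      rw [h l (by simpa using hl), norm_zero]
    · rw [tsum_eq_single 0 h]
      simp [pw]
  | succ m ih =>
    have h1 := summable_norm_psi hμ h0 t
    have key : ∀ l : ℕ, (pw μ (m + 1) l : ℂ) * Complex.exp (t * Complex.I) ^ l =
        ∑ p ∈ Finset.HasAntidiagonal.antidiagonal l,
          ((μ p.1 : ℂ) * Complex.exp (t * Complex.I) ^ p.1) *
            ((pw μ m p.2 : ℂ) * Complex.exp (t * Complex.I) ^ p.2) := by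
      intro l
      rw [pw_succ]
      push_cast
      rw [Finset.sum_mul]
      apply Finset.sum_congr rfl
      intro p hp
      rw [Finset.HasAntidiagonal.mem_antidiagonal] at hp
      rw [← hp, pow_add]; ring
    have e1 := summable_norm_sum_mul_antidiagonal_of_summable_norm
      (f := fun k : ℕ => (μ k : ℂ) * Complex.exp (t * Complex.I) ^ k)
      (g := fun l : ℕ => (pw μ m l : ℂ) * Complex.exp (t * Complex.I) ^ l) h1 ih.1
    have e2 := tsum_mul_tsum_eq_tsum_sum_antidiagonal_of_summable_norm
      (f := fun k : ℕ => (μ k : ℂ) * Complex.exp (t * Complex.I) ^ k)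
      (g := fun l : ℕ => (pw μ m l : ℂ) * Complex.exp (t * Complex.I) ^ l) h1 ih.1
    rw [ih.2] at e2
    refine ⟨(summable_congr fun l => by rw [key]).mpr e1, ?_⟩
    rw [tsum_congr key, pow_succ']
    exact e2.symm

theorem integral_cos_int (j : ℤ) :
    ∫ t in (0 : ℝ)..Real.pi, Real.cos (j * t) = if j = 0 then Real.pi else 0 := by
  split_ifs with h
  · simp [h]
  · have hj : (j : ℝ) ≠ 0 := by exact_mod_cast h
    rw [intervalIntegral.integral_comp_mul_left (fun x => Real.cos x) hj]
    simp [Real.sin_int_mul_pi]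

theorem continuous_psi {μ : ℕ → ℝ} (hμ : Summable μ) (h0 : ∀ k, 0 ≤ μ k) :
    Continuous (psi μ) := by
  unfold psi
  refine continuous_tsum (u := μ) (fun i => by fun_prop) hμ ?_
  intro k t
  simp [abs_of_nonneg, h0]

theorem continuous_phi {μ : ℕ → ℝ} (hμ : Summable μ) (h0 : ∀ k, 0 ≤ μ k) :
    Continuous (phi μ) := by
  unfold phi
  have := continuous_psi hμ h0
  fun_prop

theorem norm_phi (μ : ℕ → ℝ) (t : ℝ) : ‖phi μ t‖ = ‖psi μ t‖ := by
  unfold phi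
  rw [norm_mul, show -((t : ℂ) * Complex.I) = ((-t : ℝ) : ℂ) * Complex.I by push_cast; ring,
    norm_e, one_mul]

theorem pw_nonneg {μ : ℕ → ℝ} (h0 : ∀ k, 0 ≤ μ k) (m : ℕ) : ∀ l, 0 ≤ pw μ m l := by
  induction m with
  | zero => intro l; simp only [pw, pow_zero, PowerSeries.coeff_one]; split_ifs <;> norm_num
  | succ m ih =>
    intro l; rw [pw_succ]
    exact Finset.sum_nonneg fun p _ => mul_nonneg (h0 _) (ih _)

theorem q_eq {μ : ℕ → ℝ} (hμ : Summable μ) (h0 : ∀ k, 0 ≤ μ k) (m k : ℕ) :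
    Real.pi * q μ m k =
      ∫ t in (0 : ℝ)..Real.pi, (phi μ t ^ m * Complex.exp (k * t * Complex.I)).re := by
  have hs : Summable (pw μ m) := by
    have := (psi_pow hμ h0 0 m).1
    simpa [abs_of_nonneg, pw_nonneg h0] using this
  have hsum : ∀ t : ℝ, HasSum (fun l : ℕ => pw μ m l * Real.cos (((l : ℤ) + k - m : ℤ) * t))
      (phi μ t ^ m * Complex.exp (k * t * Complex.I)).re := by
    intro t
    have h1 : HasSum (fun l : ℕ => (pw μ m l : ℂ) * Complex.exp (t * Complex.I) ^ l)
        (psi μ t ^ m) := by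
      rw [← (psi_pow hμ h0 t m).2]
      exact (psi_pow hμ h0 t m).1.of_norm.hasSum
    have h2 := h1.mul_left (Complex.exp (-(t * Complex.I)) ^ m * Complex.exp (k * t * Complex.I))
    have h3 := Complex.hasSum_re h2
    convert h3 using 1
    · ext l
      have : Complex.exp (-(t * Complex.I)) ^ m * Complex.exp (k * t * Complex.I) *
          ((pw μ m l : ℂ) * Complex.exp (t * Complex.I) ^ l) =
          (pw μ m l : ℂ) * Complex.exp (((((l : ℤ) + k - m : ℤ) * t : ℝ) : ℂ) * Complex.I) := by
        rw [← Complex.exp_nat_mul, ← Complex.exp_nat_mul, mul_left_comm, ← Complex.exp_add,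
          ← Complex.exp_add]
        congr 2
        push_cast; ring
      rw [this, Complex.re_ofReal_mul, Complex.exp_ofReal_mul_I_re]
    · rw [phi, mul_pow]; congr 1; ring
  have hint := intervalIntegral.hasSum_integral_of_dominated_convergence
    (μ := MeasureTheory.volume) (a := 0) (b := Real.pi)
    (F := fun (l : ℕ) (t : ℝ) => pw μ m l * Real.cos (((l : ℤ) + k - m : ℤ) * t))
    (f := fun t => (phi μ t ^ m * Complex.exp (k * t * Complex.I)).re)
    (fun l _ => pw μ m l) (fun l => by
      apply Continuous.aestronglyMeasurable; fun_prop)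
    (fun l => by
      refine Filter.Eventually.of_forall fun t _ => ?_
      rw [norm_mul, Real.norm_of_nonneg (pw_nonneg h0 m l)]
      exact mul_le_of_le_one_right (pw_nonneg h0 m l) (Real.abs_cos_le_one _))
    (Filter.Eventually.of_forall fun t _ => hs)
    (by simp)
    (Filter.Eventually.of_forall fun t _ => hsum t)
  rw [← hint.tsum_eq]
  simp_rw [intervalIntegral.integral_const_mul, integral_cos_int]
  unfold q
  split_ifs with h
  · rw [tsum_eq_single (m - k)]
    · rw [if_pos (by omega)]; ring
    · intro l hl
      rw [if_neg (by omega), mul_zero]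
  · rw [mul_zero]; symm
    convert tsum_zero with l
    rw [if_neg (by omega), mul_zero]

/-- Real part of `1 - psi`. -/
def D (μ : ℕ → ℝ) (t : ℝ) : ℝ := ∑' k : ℕ, μ k * (1 - Real.cos (k * t))

theorem summable_D {μ : ℕ → ℝ} (hμ : Summable μ) (h0 : ∀ k, 0 ≤ μ k) (t : ℝ) :
    Summable fun k : ℕ => μ k * (1 - Real.cos (k * t)) := by
  apply Summable.of_nonneg_of_le _ _ (hμ.mul_right 2)
  · intro k; exact mul_nonneg (h0 k) (by linarith [Real.cos_le_one (k * t)])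
  · intro k; exact mul_le_mul_of_nonneg_left (by linarith [Real.neg_one_le_cos (k * t)]) (h0 k)

theorem continuous_D {μ : ℕ → ℝ} (hμ : Summable μ) (h0 : ∀ k, 0 ≤ μ k) :
    Continuous (D μ) := by
  unfold D
  refine continuous_tsum (u := fun k => μ k * 2) (fun i => by fun_prop) (hμ.mul_right 2) ?_
  intro k t
  rw [norm_mul, Real.norm_of_nonneg (h0 k), Real.norm_of_nonneg (by linarith [Real.cos_le_one (k * t)])]
  exact mul_le_mul_of_nonneg_left (by linarith [Real.neg_one_le_cos (k * t)]) (h0 k)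

theorem D_nonneg {μ : ℕ → ℝ} (h0 : ∀ k, 0 ≤ μ k) (t : ℝ) : 0 ≤ D μ t :=
  tsum_nonneg fun k => mul_nonneg (h0 k) (by linarith [Real.cos_le_one (k * t)])

theorem psi_re {μ : ℕ → ℝ} (hμ : HasSum μ 1) (h0 : ∀ k, 0 ≤ μ k) (t : ℝ) :
    (psi μ t).re = 1 - D μ t := by
  have h1 : HasSum (fun k : ℕ => (μ k : ℂ) * Complex.exp (t * Complex.I) ^ k) (psi μ t) :=
    (summable_norm_psi hμ.summable h0 t).of_norm.hasSum
  have h2 := Complex.hasSum_re h1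
  have h3 := hμ.sub (summable_D hμ.summable h0 t).hasSum
  refine h2.unique ?_
  have h4 : (fun k : ℕ => ((μ k : ℂ) * Complex.exp (t * Complex.I) ^ k).re) =
      fun k : ℕ => μ k - μ k * (1 - Real.cos (k * t)) := by
    funext k
    rw [← Complex.exp_nat_mul, show (k : ℂ) * (t * Complex.I) = ((k * t : ℝ) : ℂ) * Complex.I by
      push_cast; ring, Complex.re_ofReal_mul, Complex.exp_ofReal_mul_I_re]
    ring
  rw [h4]
  exact h3

theorem norm_psi_sq_le {μ : ℕ → ℝ} (hμ : HasSum μ 1) (h0 : ∀ k, 0 ≤ μ k) (t : ℝ) :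
    ‖psi μ t‖ ^ 2 ≤ 1 - 2 * μ 0 * D μ t := by
  have h1 := (summable_norm_psi hμ.summable h0 t)
  have hz : psi μ t = μ 0 + ∑' k : ℕ, (μ (k + 1) : ℂ) * Complex.exp (t * Complex.I) ^ (k + 1) := by
    unfold psi
    rw [h1.of_norm.tsum_eq_zero_add]; simp
  set z := ∑' k : ℕ, (μ (k + 1) : ℂ) * Complex.exp (t * Complex.I) ^ (k + 1) with hzdef
  have hnz : ‖z‖ ≤ 1 - μ 0 := by
    have h2 : Summable fun k : ℕ => ‖(μ (k + 1) : ℂ) * Complex.exp (t * Complex.I) ^ (k + 1)‖ :=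
      (summable_nat_add_iff 1).mpr h1
    refine (norm_tsum_le_tsum_norm h2).trans ?_
    have h3 := hμ.summable.tsum_eq_zero_add
    rw [hμ.tsum_eq] at h3
    rw [h3]
    simp [abs_of_nonneg, h0]
  have hre := psi_re hμ h0 t
  have e : ‖psi μ t‖ ^ 2 = μ 0 ^ 2 + 2 * μ 0 * z.re + ‖z‖ ^ 2 := by
    rw [hz, ← Complex.normSq_eq_norm_sq, ← Complex.normSq_eq_norm_sq, Complex.normSq_apply,
      Complex.normSq_apply]
    simp; ring
  have hre2 : z.re = 1 - D μ t - μ 0 := by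
    rw [hz] at hre; simp at hre; linarith
  have h5 : ‖z‖ ^ 2 ≤ (1 - μ 0) ^ 2 := by
    have := norm_nonneg z
    nlinarith
  rw [e, hre2]
  nlinarith

theorem norm_phi_pow_le {μ : ℕ → ℝ} (hμ : HasSum μ 1) (h0 : ∀ k, 0 ≤ μ k) (t : ℝ) (n : ℕ) :
    ‖phi μ t‖ ^ n ≤ Real.exp (-(μ 0 * (n * D μ t))) := by
  have h := norm_psi_sq_le hμ h0 t
  have h2 : ‖psi μ t‖ ^ 2 ≤ Real.exp (-(μ 0 * D μ t)) ^ 2 := by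
    rw [← Real.exp_nat_mul]
    refine h.trans ?_
    have := Real.add_one_le_exp (((2 : ℕ) : ℝ) * -(μ 0 * D μ t))
    push_cast at this ⊢
    linarith
  have h3 : ‖psi μ t‖ ≤ Real.exp (-(μ 0 * D μ t)) :=
    le_of_sq_le_sq h2 (Real.exp_pos _).le
  rw [norm_phi]
  calc _ ≤ Real.exp (-(μ 0 * D μ t)) ^ n := pow_le_pow_left₀ (norm_nonneg _) h3 n
    _ = _ := by rw [← Real.exp_nat_mul]; congr 1; ring

end PlaneTree

namespace PlaneTree

theorem comb_lower {u t : ℕ → ℝ} {f g : ℕ → ℕ → ℝ} {C : ℝ} (hC : 1 ≤ C)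
    (ht : ∀ n, 1 ≤ n → 0 < t n)
    (hmono : ∀ n m, 1 ≤ n → n ≤ m → t m ≤ C * t n)
    (hf : ∀ n z, 1 ≤ n → u n - C * z * t n ^ 2 ≤ f n z)
    (hg : ∀ n z, 1 ≤ n → u n - C * z * t n ^ 2 ≤ g n z)
    (hconv : ∀ n m Z, ∑ z ∈ Finset.range Z, f n z * g m z ≤ u (n + m)) {c : ℝ} (hc : 0 < c) :
    ∃ c' : ℝ, 0 < c' ∧ ∀ n m, 1 ≤ n → 1 ≤ m → c * t n ≤ u n → c * t m ≤ u m →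
      c' * t (n + m) ≤ u (n + m) := by
  refine ⟨c ^ 3 / (8 * C ^ 2), by positivity, ?_⟩
  intro n m hn hm hun hum
  have hC0 : 0 < C := by linarith
  have htn := ht n hn
  have htm := ht m hm
  set T := max (t n) (t m) with hT
  have hTn : t n ≤ T := le_max_left _ _
  have hTm : t m ≤ T := le_max_right _ _
  have hT0 : 0 < T := lt_of_lt_of_le htn hTn
  set X := c / (2 * C * T) with hX
  have hX0 : 0 < X := by positivity
  have key : ∀ z : ℕ, z < ⌈X⌉₊ → ∀ s, 0 < s → s ≤ T → C * z * s ^ 2 ≤ c / 2 * s := by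
    intro z hz s hs hsT
    have h1 : (z : ℝ) < X := Nat.lt_ceil.mp hz
    have h2 : (z : ℝ) * (2 * C * T) < c := by
      rw [hX, lt_div_iff₀ (by positivity)] at h1; exact h1
    have h3 : (z : ℝ) * (C * s) ≤ z * (C * T) := by gcongr
    nlinarith
  have hsum : (⌈X⌉₊ : ℝ) * (c / 2 * t n * (c / 2 * t m)) ≤ u (n + m) := by
    refine le_trans ?_ (hconv n m ⌈X⌉₊)
    rw [← nsmul_eq_mul, ← Finset.card_range ⌈X⌉₊, ← Finset.sum_const]
    simp only [Finset.card_range]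
    apply Finset.sum_le_sum
    intro z hz
    have hz' := Finset.mem_range.mp hz
    have h1 := hf n z hn
    have h2 := hg m z hm
    have k1 := key z hz' _ htn hTn
    have k2 := key z hz' _ htm hTm
    have : 0 < c / 2 * t n := by positivity
    apply mul_le_mul <;> first | positivity | nlinarith
  have hmul : t n * t m = T * min (t n) (t m) := by
    rw [hT, mul_comm (max _ _), min_mul_max]
  have hmin : t (n + m) ≤ C * min (t n) (t m) := by
    rcases min_choice (t n) (t m) with h | h <;> rw [h]
    · exact hmono n _ hn (by omega)
    · exact hmono m _ hm (by omega)
  have hmin0 : 0 < min (t n) (t m) := lt_min htn htm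
  calc c ^ 3 / (8 * C ^ 2) * t (n + m) ≤ c ^ 3 / (8 * C ^ 2) * (C * min (t n) (t m)) := by gcongr
    _ = X * (c / 2 * t n * (c / 2 * t m)) := by
        rw [show c / 2 * t n * (c / 2 * t m) = c ^ 2 / 4 * (t n * t m) by ring, hmul, hX]
        field_simp
        ring
    _ ≤ (⌈X⌉₊ : ℝ) * (c / 2 * t n * (c / 2 * t m)) := by
        gcongr; exact Nat.le_ceil X
    _ ≤ _ := hsum

theorem multi_lower {u t : ℕ → ℝ}
    (ht : ∀ n, 1 ≤ n → 0 < t n)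
    (hcomb : ∀ c : ℝ, 0 < c → ∃ c' : ℝ, 0 < c' ∧ ∀ n m, 1 ≤ n → 1 ≤ m → c * t n ≤ u n →
      c * t m ≤ u m → c' * t (n + m) ≤ u (n + m)) {c : ℝ} (hc : 0 < c) (J : ℕ) :
    ∃ c' : ℝ, 0 < c' ∧ ∀ j, 1 ≤ j → j ≤ J → ∀ n h, 1 ≤ n →
      (∀ x, n ≤ x → x ≤ n + h → c * t x ≤ u x) →
      ∀ N, j * n ≤ N → N ≤ j * (n + h) → c' * t N ≤ u N := by
  induction J with
  | zero => exact ⟨1, one_pos, fun j h1 h2 => by omega⟩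
  | succ J ih =>
    obtain ⟨c1, hc1, h1⟩ := ih
    obtain ⟨c2, hc2, h2⟩ := hcomb (min c c1) (lt_min hc hc1)
    refine ⟨min c c2, lt_min hc hc2, ?_⟩
    intro j hj hjJ n h hn hgood N hN1 hN2
    have weak : ∀ a b : ℝ, ∀ x, 1 ≤ x → a ≤ b → b * t x ≤ u x → a * t x ≤ u x := by
      intro a b x hx hab hb
      exact le_trans (mul_le_mul_of_nonneg_right hab (ht x hx).le) hb
    rcases Nat.lt_or_ge j 2 with h2' | h2'
    · have : j = 1 := by omega
      subst this
      exact weak _ _ _ (by omega) (min_le_left _ _) (hgood N (by omega) (by omega))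
    · obtain ⟨i, rfl⟩ : ∃ i, j = i + 1 := ⟨j - 1, by omega⟩
      have e1 : (i + 1) * n = i * n + n := by ring
      have e2 : (i + 1) * (n + h) = i * (n + h) + (n + h) := by ring
      have e3 : i * n ≤ i * (n + h) := Nat.mul_le_mul_left _ (by omega)
      have e4 : 1 * n ≤ i * n := Nat.mul_le_mul_right _ (by omega)
      rw [e1] at hN1
      rw [e2] at hN2
      obtain ⟨M, x, hM1, hM2, hx1, hx2, hMx⟩ : ∃ M x, i * n ≤ M ∧ M ≤ i * (n + h) ∧ n ≤ x ∧
          x ≤ n + h ∧ M + x = N := by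
        refine ⟨max (i * n) (N - (n + h)), N - max (i * n) (N - (n + h)), ?_, ?_, ?_, ?_, ?_⟩ <;>
          omega
      have g1 := h1 i (by omega) (by omega) n h hn hgood M hM1 hM2
      have g2 := hgood x hx1 hx2
      have g3 := h2 M x (by omega) (by omega)
        (weak _ _ _ (by omega) (min_le_right _ _) g1) (weak _ _ _ (by omega) (min_le_left _ _) g2)
      rw [hMx] at g3
      exact weak _ _ _ (by omega) (min_le_right _ _) g3

theorem sum_rpow_neg_le {θ : ℝ} (h0 : 0 < θ) (h1 : θ < 1) (X : ℕ) :
    ∑ n ∈ Finset.range X, ((n + 1 : ℕ) : ℝ) ^ (-θ) ≤ (X : ℝ) ^ (1 - θ) / (1 - θ) := by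
  have hθ : 0 < 1 - θ := by linarith
  induction X with
  | zero => simp [Real.zero_rpow hθ.ne']
  | succ X ih =>
    rw [Finset.sum_range_succ]
    have hp : (0 : ℝ) < ((X + 1 : ℕ) : ℝ) := by positivity
    have hb := rpow_one_add_le_one_add_mul_self (s := -(1 / ((X + 1 : ℕ) : ℝ))) (p := 1 - θ)
      (by
        rw [neg_le_neg_iff, div_le_one hp]; push_cast; linarith [Nat.cast_nonneg (α := ℝ) X])
      hθ.le (by linarith)
    have e : (X : ℝ) = ((X + 1 : ℕ) : ℝ) * (1 + -(1 / ((X + 1 : ℕ) : ℝ))) := by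
      field_simp; push_cast; ring
    have hX : (X : ℝ) ^ (1 - θ) ≤ ((X + 1 : ℕ) : ℝ) ^ (1 - θ) *
        (1 + (1 - θ) * -(1 / ((X + 1 : ℕ) : ℝ))) := by
      conv_lhs => rw [e]
      rw [Real.mul_rpow hp.le (by
        have : 1 / ((X + 1 : ℕ) : ℝ) ≤ 1 := by
          rw [div_le_one hp]; push_cast; linarith [Nat.cast_nonneg (α := ℝ) X]
        linarith)]
      gcongr
    have e2 : ((X + 1 : ℕ) : ℝ) ^ (1 - θ) = ((X + 1 : ℕ) : ℝ) ^ (-θ) * ((X + 1 : ℕ) : ℝ) := by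
      rw [show (1 - θ) = -θ + 1 by ring, Real.rpow_add_one hp.ne']
    rw [le_div_iff₀ hθ] at ih ⊢
    have e3 : ((X + 1 : ℕ) : ℝ) ^ (1 - θ) * (1 + (1 - θ) * -(1 / ((X + 1 : ℕ) : ℝ))) =
        ((X + 1 : ℕ) : ℝ) ^ (1 - θ) - (1 - θ) * ((X + 1 : ℕ) : ℝ) ^ (-θ) := by
      rw [e2]; field_simp; ring
    rw [e3] at hX
    linarith

end PlaneTree

namespace PlaneTree

theorem good_exists {u t : ℕ → ℝ} {C θ c1 : ℝ} (hC : 1 ≤ C) (hθ0 : 0 < θ) (hθ1 : θ < 1)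
    (hc1 : 0 < c1)
    (ht : ∀ n, 1 ≤ n → 0 < t n) (hu : ∀ n, 0 ≤ u n) (hu1 : u 0 ≤ 1)
    (hup : ∀ n, 1 ≤ n → u n ≤ C * t n)
    (hmono : ∀ n m, 1 ≤ n → n ≤ m → t m ≤ C * t n)
    (hgrow : ∀ n m : ℕ, 1 ≤ n → n ≤ m → t n ≤ C * ((m : ℝ) / n) ^ θ * t m)
    (hsm : ∀ M : ℕ, 1 ≤ M → Summable fun n : ℕ => (1 - 1 / (M : ℝ)) ^ n * u n)
    (hgreen : ∀ M : ℕ, 1 ≤ M → c1 * (M * t M) ≤ ∑' n : ℕ, (1 - 1 / (M : ℝ)) ^ n * u n) :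
    ∃ c : ℝ, 0 < c ∧ ∃ ε : ℝ, 0 < ε ∧ ∃ K : ℕ, ∀ᶠ M : ℕ in atTop, ∃ n : ℕ,
      ε * M ≤ n ∧ n ≤ K * M ∧ c * t n ≤ u n := by
  have hθ : 0 < 1 - θ := by linarith
  have hC0 : 0 < C := by linarith
  -- choice of ε
  obtain ⟨ε, hε0, hε1, hε⟩ : ∃ ε : ℝ, 0 < ε ∧ ε ≤ 1 ∧ C ^ 2 * (ε ^ (1 - θ) / (1 - θ)) ≤ c1 / 4 := by
    have h1 : Tendsto (fun ε : ℝ => C ^ 2 * (ε ^ (1 - θ) / (1 - θ))) (nhdsWithin 0 (Ioi 0))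
        (nhds (C ^ 2 * (0 ^ (1 - θ) / (1 - θ)))) := by
      apply Tendsto.mono_left _ nhdsWithin_le_nhds
      apply Tendsto.const_mul
      apply Tendsto.div_const
      exact (Real.continuousAt_rpow_const 0 (1 - θ) (Or.inr hθ.le)).tendsto
    rw [Real.zero_rpow hθ.ne', zero_div, mul_zero] at h1
    have h2 := h1.eventually (gt_mem_nhds (show (0 : ℝ) < c1 / 4 by positivity))
    have h3 : ∀ᶠ ε : ℝ in nhdsWithin 0 (Ioi 0), ε ∈ Ioc (0 : ℝ) 1 :=
      Ioc_mem_nhdsGT one_pos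
    obtain ⟨ε, h4, h5⟩ := (h2.and h3).exists
    exact ⟨ε, h5.1, h5.2, h4.le⟩
  obtain ⟨K, hK1, hK⟩ : ∃ K : ℕ, 2 ≤ K ∧ C ^ 2 * Real.exp (-(K : ℝ)) ≤ c1 / 4 := by
    have h1 : Tendsto (fun K : ℕ => C ^ 2 * Real.exp (-(K : ℝ))) atTop (nhds (C ^ 2 * 0)) := by
      apply Tendsto.const_mul
      exact Real.tendsto_exp_neg_atTop_nhds_zero.comp tendsto_natCast_atTop_atTop
    rw [mul_zero] at h1
    have h2 := h1.eventually (gt_mem_nhds (show (0 : ℝ) < c1 / 4 by positivity))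
    obtain ⟨K, h4, h5⟩ := (h2.and (eventually_ge_atTop 2)).exists
    exact ⟨K, h5, h4.le⟩
  have hK0 : (0 : ℝ) < K := by exact_mod_cast (by omega : 0 < K)
  set C' := C * (1 / ε) ^ θ with hC'
  have hεθ : 1 ≤ (1 / ε) ^ θ := Real.one_le_rpow (by rw [le_div_iff₀ hε0]; linarith) hθ0.le
  have hC'0 : 0 < C' := by positivity
  refine ⟨c1 / (8 * K * C'), by positivity, ε, hε0, K, ?_⟩
  have hbig : ∀ᶠ M : ℕ in atTop, 1 < c1 / 4 * (M * t M) := by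
    have h1 : Tendsto (fun M : ℕ => c1 / 4 * (t 1 / C) * (M : ℝ) ^ (1 - θ)) atTop atTop := by
      apply Tendsto.const_mul_atTop
      · have := ht 1 le_rfl; positivity
      · exact (tendsto_rpow_atTop hθ).comp tendsto_natCast_atTop_atTop
    filter_upwards [h1.eventually_gt_atTop 1, eventually_ge_atTop 1] with M hM hM1
    refine lt_of_lt_of_le hM ?_
    have h2 := hgrow 1 M le_rfl hM1
    have hM0 : (0 : ℝ) < M := by exact_mod_cast hM1
    have e : (M : ℝ) = (M : ℝ) ^ (1 - θ) * (M : ℝ) ^ θ := by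
      rw [← Real.rpow_add hM0]; simp
    rw [mul_assoc]
    refine mul_le_mul_of_nonneg_left ?_ (by positivity)
    rw [div_mul_eq_mul_div, div_le_iff₀ hC0]
    rw [Nat.cast_one, div_one] at h2
    have hx : 0 < (M : ℝ) ^ (1 - θ) := by positivity
    calc t 1 * (M : ℝ) ^ (1 - θ) ≤ (C * (M : ℝ) ^ θ * t M) * (M : ℝ) ^ (1 - θ) := by gcongr
      _ = ((M : ℝ) ^ (1 - θ) * (M : ℝ) ^ θ) * t M * C := by ring
      _ = _ := by rw [← e]
  filter_upwards [hbig, eventually_ge_atTop 1] with M hM hM1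
  by_contra! hcon
  have hM0 : (0 : ℝ) < M := by exact_mod_cast hM1
  have htM := ht M hM1
  set r : ℝ := 1 - 1 / (M : ℝ) with hr
  have hr0 : 0 ≤ r := by
    rw [hr, sub_nonneg, div_le_one hM0]; exact_mod_cast hM1
  have hr1 : r < 1 := by
    rw [hr]; have : 0 < 1 / (M : ℝ) := by positivity
    linarith
  set X := ⌊ε * M⌋₊ with hX
  have hXle : (X : ℝ) ≤ ε * M := Nat.floor_le (by positivity)
  have hXM : X ≤ M := by
    have : (X : ℝ) ≤ M := hXle.trans (by nlinarith)
    exact_mod_cast this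
  have hYX : X + 1 ≤ K * M := by nlinarith
  have hrn : ∀ n, r ^ n ≤ 1 := fun n => pow_le_one₀ hr0 hr1.le
  have S1 : ∑ n ∈ Finset.range (X + 1), r ^ n * u n ≤ 1 + c1 / 4 * (M * t M) := by
    rw [Finset.sum_range_succ', add_comm]
    apply add_le_add
    · simpa using hu1
    · calc ∑ i ∈ Finset.range X, r ^ (i + 1) * u (i + 1)
          ≤ ∑ i ∈ Finset.range X, (C ^ 2 * (M : ℝ) ^ θ * t M) * ((i + 1 : ℕ) : ℝ) ^ (-θ) := by
            apply Finset.sum_le_sum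
            intro i hi
            have hi' := Finset.mem_range.mp hi
            have h1 := hup (i + 1) (by omega)
            have h2 := hgrow (i + 1) M (by omega) (by omega)
            have hp : (0 : ℝ) < ((i + 1 : ℕ) : ℝ) := by positivity
            rw [Real.div_rpow hM0.le hp.le] at h2
            rw [Real.rpow_neg hp.le]
            calc r ^ (i + 1) * u (i + 1) ≤ 1 * u (i + 1) := by
                  gcongr
                  · exact hu _
                  · exact hrn _
              _ ≤ C * (C * ((M : ℝ) ^ θ / ((i + 1 : ℕ) : ℝ) ^ θ) * t M) := by
                  rw [one_mul]; exact h1.trans (by gcongr)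
              _ = _ := by ring
        _ ≤ (C ^ 2 * (M : ℝ) ^ θ * t M) * ((X : ℝ) ^ (1 - θ) / (1 - θ)) := by
            rw [← Finset.mul_sum]
            gcongr
            exact sum_rpow_neg_le hθ0 hθ1 X
        _ ≤ (C ^ 2 * (M : ℝ) ^ θ * t M) * ((ε * M) ^ (1 - θ) / (1 - θ)) := by gcongr
        _ = (C ^ 2 * (ε ^ (1 - θ) / (1 - θ))) * (((M : ℝ) ^ θ * (M : ℝ) ^ (1 - θ)) * t M) := by
            rw [Real.mul_rpow hε0.le hM0.le]; ring
        _ = (C ^ 2 * (ε ^ (1 - θ) / (1 - θ))) * (M * t M) := by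
            rw [← Real.rpow_add hM0]; simp
        _ ≤ _ := by gcongr
  have S2 : ∑ n ∈ Finset.Ico (X + 1) (K * M), r ^ n * u n ≤ c1 / 8 * (M * t M) := by
    calc ∑ n ∈ Finset.Ico (X + 1) (K * M), r ^ n * u n
        ≤ ∑ n ∈ Finset.Ico (X + 1) (K * M), c1 / (8 * K) * t M := by
          apply Finset.sum_le_sum
          intro n hn
          rw [Finset.mem_Ico] at hn
          have h0 : ε * M < n := (Nat.lt_floor_add_one _).trans_le (by exact_mod_cast hn.1)
          have h1 := hcon n h0.le (by omega)
          have hn0 : (0 : ℝ) < n := by exact_mod_cast (by omega : 0 < n)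
          have h2 : t n ≤ C' * t M := by
            rcases le_total n M with h | h
            · refine (hgrow n M (by omega) h).trans ?_
              rw [hC']
              have : (M : ℝ) / n ≤ 1 / ε := by
                rw [div_le_div_iff₀ hn0 hε0]; linarith
              gcongr
            · refine (hmono M n hM1 h).trans ?_
              rw [hC']
              gcongr
              nlinarith
          calc r ^ n * u n ≤ 1 * u n := by
                gcongr
                · exact hu _
                · exact hrn _
            _ ≤ c1 / (8 * K * C') * (C' * t M) := by
                rw [one_mul]; exact h1.le.trans (by gcongr)
            _ = _ := by field_simp
      _ ≤ (K * M : ℕ) * (c1 / (8 * K) * t M) := by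
          rw [Finset.sum_const, nsmul_eq_mul]
          gcongr
          simp
      _ = _ := by push_cast; field_simp
  have S3 : ∑' n : ℕ, r ^ (n + K * M) * u (n + K * M) ≤ c1 / 4 * (M * t M) := by
    have hs := hsm M hM1
    have hle : ∀ n : ℕ, r ^ (n + K * M) * u (n + K * M) ≤ (r ^ (K * M) * (C ^ 2 * t M)) * r ^ n := by
      intro n
      have hKM : M ≤ n + K * M := by nlinarith
      have h1 := hup (n + K * M) (by omega)
      have h2 := hmono M (n + K * M) hM1 hKM
      have : u (n + K * M) ≤ C ^ 2 * t M := by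
        refine h1.trans ?_
        rw [sq, mul_assoc]; gcongr
      rw [pow_add]
      calc r ^ n * r ^ (K * M) * u (n + K * M) ≤ r ^ n * r ^ (K * M) * (C ^ 2 * t M) := by gcongr
        _ = _ := by ring
    have hgeo := (hasSum_geometric_of_lt_one hr0 hr1).mul_left (r ^ (K * M) * (C ^ 2 * t M))
    have h3 := Summable.tsum_le_tsum hle ((summable_nat_add_iff (K * M)).mpr hs) hgeo.summable
    rw [hgeo.tsum_eq] at h3
    refine h3.trans ?_
    have e1 : (1 - r)⁻¹ = M := by rw [hr]; simp
    have e2 : r ^ (K * M) ≤ Real.exp (-(K : ℝ)) := by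
      have : r ≤ Real.exp (-(1 / (M : ℝ))) := by
        have := Real.add_one_le_exp (-(1 / (M : ℝ)))
        rw [hr]; linarith
      calc r ^ (K * M) ≤ Real.exp (-(1 / (M : ℝ))) ^ (K * M) := by gcongr
        _ = Real.exp (-(K : ℝ)) := by
          rw [← Real.exp_nat_mul]; congr 1; push_cast; field_simp
    rw [e1]
    calc r ^ (K * M) * (C ^ 2 * t M) * M ≤ Real.exp (-(K : ℝ)) * (C ^ 2 * t M) * M := by gcongr
      _ = (C ^ 2 * Real.exp (-(K : ℝ))) * (M * t M) := by ring
      _ ≤ _ := by gcongr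
  have hg := hgreen M hM1
  rw [← (hsm M hM1).sum_add_tsum_nat_add (K * M),
    ← Finset.sum_range_add_sum_Ico _ hYX] at hg
  have : 0 < c1 * (M * t M) := by positivity
  linarith

theorem lower_all {u t : ℕ → ℝ} {C : ℝ} (hC : 1 ≤ C)
    (ht : ∀ n, 1 ≤ n → 0 < t n)
    (hmono : ∀ n m, 1 ≤ n → n ≤ m → t m ≤ C * t n)
    (htime : ∀ n i : ℕ, 1 ≤ n → u n - C * i * (t n / n) ≤ u (n + i))
    (hcomb : ∀ c : ℝ, 0 < c → ∃ c' : ℝ, 0 < c' ∧ ∀ n m, 1 ≤ n → 1 ≤ m → c * t n ≤ u n →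
      c * t m ≤ u m → c' * t (n + m) ≤ u (n + m))
    (hgood : ∃ c : ℝ, 0 < c ∧ ∃ ε : ℝ, 0 < ε ∧ ∃ K : ℕ, ∀ᶠ M : ℕ in atTop, ∃ n : ℕ,
      ε * M ≤ n ∧ n ≤ K * M ∧ c * t n ≤ u n) :
    ∃ c : ℝ, 0 < c ∧ ∀ᶠ N : ℕ in atTop, c * t N ≤ u N := by
  obtain ⟨c, hc, ε, hε, K, hM⟩ := hgood
  have hC0 : 0 < C := by linarith
  set δ := c / (2 * C) with hδ
  have hδ0 : 0 < δ := by positivity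
  have hblock : ∀ n : ℕ, 1 ≤ n → c * t n ≤ u n → ∀ x, n ≤ x → x ≤ n + ⌊δ * n⌋₊ →
      δ * t x ≤ u x := by
    intro n hn hun x hx1 hx2
    obtain ⟨i, rfl⟩ := Nat.exists_eq_add_of_le hx1
    have hn0 : (0 : ℝ) < n := by exact_mod_cast hn
    have hi : (i : ℝ) ≤ δ * n := by
      have : i ≤ ⌊δ * n⌋₊ := by omega
      exact (Nat.cast_le.mpr this).trans (Nat.floor_le (by positivity))
    have h1 := htime n i hn
    have h2 := hmono n (n + i) hn (by omega)
    have htn := ht n hn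
    have h3 : C * i * (t n / n) ≤ c / 2 * t n := by
      calc C * i * (t n / n) ≤ C * (δ * n) * (t n / n) := by gcongr
        _ = _ := by rw [hδ]; field_simp
    calc δ * t (n + i) ≤ δ * (C * t n) := by gcongr
      _ = c / 2 * t n := by rw [hδ]; field_simp
      _ ≤ _ := by linarith
  set J0 : ℕ := ⌈2 / δ⌉₊ + 1 with hJ0
  have hJ0' : 2 / δ ≤ J0 := by
    rw [hJ0]; push_cast; linarith [Nat.le_ceil (2 / δ)]
  set P : ℕ := (K + 1) * J0 with hP
  have hP0 : 0 < P := by positivity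
  set J : ℕ := ⌈2 * P / ε⌉₊ with hJ
  obtain ⟨c', hc', hmul⟩ := multi_lower ht hcomb hδ0 J
  refine ⟨c', hc', ?_⟩
  have hdiv : Tendsto (fun N : ℕ => N / P) atTop atTop := Nat.tendsto_div_const_atTop hP0.ne'
  filter_upwards [hdiv.eventually hM, hdiv.eventually (eventually_ge_atTop 1),
    hdiv.eventually (eventually_ge_atTop ⌈1 / (δ * ε)⌉₊)] with N hN hN1 hN2
  obtain ⟨n, hn1, hn2, hn3⟩ := hN
  set M := N / P with hMdef
  have hM0 : (0 : ℝ) < M := by exact_mod_cast hN1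
  have hn0 : (0 : ℝ) < n := lt_of_lt_of_le (by positivity) hn1
  have hn : 1 ≤ n := by exact_mod_cast hn0
  have hMP : M * P ≤ N := Nat.div_mul_le_self N P
  have hMP2 : N < (M + 1) * P := by
    rw [hMdef, mul_comm]; exact Nat.lt_mul_div_succ N hP0
  have hnJ : J0 * n ≤ N := by
    calc J0 * n ≤ J0 * (K * M) := Nat.mul_le_mul_left _ hn2
      _ ≤ M * P := by rw [hP]; nlinarith [Nat.zero_le (J0 * M)]
      _ ≤ N := hMP
  have hj1 : J0 ≤ N / n := (Nat.le_div_iff_mul_le hn).mpr hnJ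
  have hj2 : N / n ≤ J := by
    have h1 : ((N / n : ℕ) : ℝ) ≤ (N : ℝ) / n := Nat.cast_div_le
    have h2 : (N : ℝ) / n ≤ 2 * P / ε := by
      rw [div_le_div_iff₀ hn0 hε]
      have h3 : (N : ℝ) ≤ (M + 1) * P := by exact_mod_cast hMP2.le
      have h4 : ((M : ℝ) + 1) ≤ 2 * M := by
        have : (1 : ℝ) ≤ M := by exact_mod_cast hN1
        linarith
      calc (N : ℝ) * ε ≤ (2 * M * P) * ε := by
            gcongr; exact h3.trans (by gcongr)
        _ = 2 * P * (ε * M) := by ring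
        _ ≤ 2 * P * n := by gcongr
    exact Nat.cast_le.mp ((h1.trans h2).trans (Nat.le_ceil _))
  have hdn : 1 ≤ δ * n := by
    have h1 : 1 / (δ * ε) ≤ M := (Nat.le_ceil _).trans (by exact_mod_cast hN2)
    rw [div_le_iff₀ (by positivity)] at h1
    nlinarith
  have hh : δ * n / 2 ≤ ⌊δ * n⌋₊ := by
    have h1 := Nat.lt_floor_add_one (δ * n)
    have h2 : (1 : ℝ) ≤ ⌊δ * n⌋₊ := by
      exact_mod_cast (Nat.one_le_floor_iff _).mpr hdn
    linarith
  have hjh : n ≤ N / n * ⌊δ * n⌋₊ := by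
    have h1 : (n : ℝ) ≤ J0 * ⌊δ * n⌋₊ := by
      calc (n : ℝ) = 2 / δ * (δ * n / 2) := by field_simp
        _ ≤ J0 * ⌊δ * n⌋₊ := by gcongr
    have h2 : n ≤ J0 * ⌊δ * n⌋₊ := by exact_mod_cast h1
    exact h2.trans (Nat.mul_le_mul_right _ hj1)
  refine hmul (N / n) (by omega) hj2 n ⌊δ * n⌋₊ hn (hblock n hn hn3) N (Nat.div_mul_le_self N n) ?_
  have h5 : N < n * (N / n + 1) := Nat.lt_mul_div_succ N hn
  nlinarith

end PlaneTree

namespace PlaneTree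

theorem pwp_eq {μ : ℕ → ℝ} (hμ : Summable μ) (h0 : ∀ k, 0 ≤ μ k) (m k : ℕ) :
    Real.pi * pw μ m (m + k) =
      ∫ t in (0 : ℝ)..Real.pi, (phi μ t ^ m * Complex.exp (-(k * t * Complex.I))).re := by
  have hs : Summable (pw μ m) := by
    have := (psi_pow hμ h0 0 m).1
    simpa [abs_of_nonneg, pw_nonneg h0] using this
  have hsum : ∀ t : ℝ, HasSum (fun l : ℕ => pw μ m l * Real.cos (((l : ℤ) - k - m : ℤ) * t))
      (phi μ t ^ m * Complex.exp (-(k * t * Complex.I))).re := by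
    intro t
    have h1 : HasSum (fun l : ℕ => (pw μ m l : ℂ) * Complex.exp (t * Complex.I) ^ l)
        (psi μ t ^ m) := by
      rw [← (psi_pow hμ h0 t m).2]
      exact (psi_pow hμ h0 t m).1.of_norm.hasSum
    have h2 := h1.mul_left (Complex.exp (-(t * Complex.I)) ^ m * Complex.exp (-(k * t * Complex.I)))
    have h3 := Complex.hasSum_re h2
    convert h3 using 1
    · ext l
      have : Complex.exp (-(t * Complex.I)) ^ m * Complex.exp (-(k * t * Complex.I)) *
          ((pw μ m l : ℂ) * Complex.exp (t * Complex.I) ^ l) =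
          (pw μ m l : ℂ) * Complex.exp (((((l : ℤ) - k - m : ℤ) * t : ℝ) : ℂ) * Complex.I) := by
        rw [← Complex.exp_nat_mul, ← Complex.exp_nat_mul, mul_left_comm, ← Complex.exp_add,
          ← Complex.exp_add]
        congr 2
        push_cast; ring
      rw [this, Complex.re_ofReal_mul, Complex.exp_ofReal_mul_I_re]
    · rw [phi, mul_pow]; congr 1; ring
  have hint := intervalIntegral.hasSum_integral_of_dominated_convergence
    (μ := MeasureTheory.volume) (a := 0) (b := Real.pi)
    (F := fun (l : ℕ) (t : ℝ) => pw μ m l * Real.cos (((l : ℤ) - k - m : ℤ) * t))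
    (f := fun t => (phi μ t ^ m * Complex.exp (-(k * t * Complex.I))).re)
    (fun l _ => pw μ m l) (fun l => by
      apply Continuous.aestronglyMeasurable; fun_prop)
    (fun l => by
      refine Filter.Eventually.of_forall fun t _ => ?_
      rw [norm_mul, Real.norm_of_nonneg (pw_nonneg h0 m l)]
      exact mul_le_of_le_one_right (pw_nonneg h0 m l) (Real.abs_cos_le_one _))
    (Filter.Eventually.of_forall fun t _ => hs)
    (by simp)
    (Filter.Eventually.of_forall fun t _ => hsum t)
  rw [← hint.tsum_eq]
  simp_rw [intervalIntegral.integral_const_mul, integral_cos_int]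
  rw [tsum_eq_single (m + k)]
  · rw [if_pos (by push_cast; ring)]; ring
  · intro l hl
    rw [if_neg (by omega), mul_zero]


theorem conv_lower {μ : ℕ → ℝ} (h0 : ∀ k, 0 ≤ μ k) (n m Z : ℕ) :
    ∑ z ∈ Finset.range Z, q μ n z * pw μ m (m + z) ≤ q μ (n + m) 0 := by
  have e : q μ (n + m) 0 = ∑ p ∈ Finset.HasAntidiagonal.antidiagonal (n + m),
      pw μ n p.1 * pw μ m p.2 := by
    simp only [q, Nat.zero_le, if_true, Nat.sub_zero]
    unfold pw
    rw [pow_add, PowerSeries.coeff_mul]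
  rw [e]
  have h1 : ∑ z ∈ Finset.range Z, q μ n z * pw μ m (m + z) =
      ∑ z ∈ (Finset.range Z).filter (fun z => z ≤ n), pw μ n (n - z) * pw μ m (m + z) := by
    rw [Finset.sum_filter]
    apply Finset.sum_congr rfl
    intro z _
    unfold q
    split_ifs <;> simp
  rw [h1, ← Finset.sum_image (s := (Finset.range Z).filter (fun z => z ≤ n))
    (f := fun p : ℕ × ℕ => pw μ n p.1 * pw μ m p.2) (g := fun z => (n - z, m + z))]
  · apply Finset.sum_le_sum_of_subset_of_nonneg
    · intro p hp
      rw [Finset.mem_image] at hp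
      obtain ⟨z, hz, rfl⟩ := hp
      rw [Finset.mem_filter] at hz
      rw [Finset.HasAntidiagonal.mem_antidiagonal]
      simp only
      omega
    · intro p _ _
      exact mul_nonneg (pw_nonneg h0 _ _) (pw_nonneg h0 _ _)
  · intro a _ b _ hab
    simp only [Prod.mk.injEq] at hab
    omega

/-- The basic integral controlling all the estimates. -/
def G (μ : ℕ → ℝ) (n : ℕ) : ℝ := ∫ t in (0 : ℝ)..Real.pi, Real.exp (-(μ 0 / 2 * (n * D μ t)))

theorem ineq1 {a x : ℝ} (ha : 0 < a) : x * Real.exp (-(a * x)) ≤ 2 / a * Real.exp (-(a / 2 * x)) := by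
  have h1 : Real.exp (-(a * x)) = Real.exp (-(a / 2 * x)) * Real.exp (-(a / 2 * x)) := by
    rw [← Real.exp_add]; congr 1; ring
  have h2 : a / 2 * x ≤ Real.exp (a / 2 * x) := by linarith [Real.add_one_le_exp (a / 2 * x)]
  have h3 : x * Real.exp (-(a / 2 * x)) ≤ 2 / a := by
    rw [Real.exp_neg, ← div_eq_mul_inv, div_le_iff₀ (Real.exp_pos _)]
    calc x = 2 / a * (a / 2 * x) := by field_simp
      _ ≤ _ := by gcongr
  calc x * Real.exp (-(a * x)) = (x * Real.exp (-(a / 2 * x))) * Real.exp (-(a / 2 * x)) := by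
        rw [h1]; ring
    _ ≤ _ := by gcongr

theorem int_bound {μ : ℕ → ℝ} (hμ : HasSum μ 1) (h0 : ∀ k, 0 ≤ μ k) (n : ℕ) (F : ℝ → ℝ) (B : ℝ)
    (h : ∀ t, 0 ≤ t → t ≤ Real.pi → |F t| ≤ B * Real.exp (-(μ 0 / 2 * (n * D μ t)))) :
    |∫ t in (0 : ℝ)..Real.pi, F t| ≤ B * G μ n := by
  unfold G
  rw [← intervalIntegral.integral_const_mul, ← Real.norm_eq_abs]
  apply intervalIntegral.norm_integral_le_of_norm_le Real.pi_pos.le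
  · exact Filter.Eventually.of_forall fun t ht => h t ht.1.le ht.2
  · apply Continuous.intervalIntegrable
    have := continuous_D hμ.summable h0
    fun_prop

theorem norm_phi_pow_le' {μ : ℕ → ℝ} (hμ : HasSum μ 1) (h0 : ∀ k, 0 ≤ μ k) (t : ℝ) (n : ℕ) :
    ‖phi μ t‖ ^ n ≤ Real.exp (-(μ 0 / 2 * (n * D μ t))) := by
  refine (norm_phi_pow_le hμ h0 t n).trans (Real.exp_le_exp.mpr ?_)
  have := mul_nonneg (h0 0) (mul_nonneg (Nat.cast_nonneg (α := ℝ) n) (D_nonneg h0 t))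
  linarith

theorem q_le_G {μ : ℕ → ℝ} (hμ : HasSum μ 1) (h0 : ∀ k, 0 ≤ μ k) (n k : ℕ) :
    Real.pi * q μ n k ≤ G μ n := by
  rw [q_eq hμ.summable h0]
  refine (le_abs_self _).trans ?_
  have := int_bound hμ h0 n
    (fun t => (phi μ t ^ n * Complex.exp (k * t * Complex.I)).re) 1 ?_
  · simpa using this
  · intro t _ _
    refine (Complex.abs_re_le_norm _).trans ?_
    rw [norm_mul, norm_pow, show (k : ℂ) * t * Complex.I = ((k * t : ℝ) : ℂ) * Complex.I by
      push_cast; ring, norm_e, mul_one, one_mul]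
    exact norm_phi_pow_le' hμ h0 t n

theorem norm_e_sub_one (x : ℝ) : ‖Complex.exp (x * Complex.I) - 1‖ ≤ |x| := by
  rw [mul_comm]; exact Real.norm_exp_I_mul_ofReal_sub_one_le

theorem int_re_cont {μ : ℕ → ℝ} (hμ : HasSum μ 1) (h0 : ∀ k, 0 ≤ μ k) (n : ℕ) (z : ℂ) :
    Continuous fun t : ℝ => (phi μ t ^ n * Complex.exp (z * t * Complex.I)).re := by
  have := continuous_phi hμ.summable h0
  exact Complex.continuous_re.comp (by fun_prop)

/-- Spatial regularity in a common form. -/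
theorem space_reg {μ : ℕ → ℝ} (hμ : HasSum μ 1) (h0 : ∀ k, 0 ≤ μ k) (hp : 0 < μ 0) (n : ℕ)
    {tn b : ℝ} (htn : 0 < tn) (hb : 0 < b)
    (hD : ∀ t, 0 ≤ t → t ≤ Real.pi → b * (t / tn - 1) ≤ n * D μ t) (x : ℝ) :
    |(∫ t in (0 : ℝ)..Real.pi, (phi μ t ^ n * Complex.exp (x * t * Complex.I)).re) -
      ∫ t in (0 : ℝ)..Real.pi, (phi μ t ^ n * Complex.exp ((0 : ℂ) * t * Complex.I)).re| ≤
      |x| * tn * (1 + 2 / (μ 0 * b)) * G μ n := by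
  rw [← intervalIntegral.integral_sub]
  · apply int_bound hμ h0
    intro t ht0 htp
    rw [← Complex.sub_re, ← mul_sub]
    refine (Complex.abs_re_le_norm _).trans ?_
    rw [norm_mul, norm_pow, zero_mul, zero_mul, Complex.exp_zero,
      show (x : ℂ) * t * Complex.I = ((x * t : ℝ) : ℂ) * Complex.I by push_cast; ring]
    have h1 := norm_e_sub_one (x * t)
    rw [abs_mul, abs_of_nonneg ht0] at h1
    have h2 := norm_phi_pow_le hμ h0 t n
    set y := (n : ℝ) * D μ t with hy
    have hy0 : 0 ≤ y := mul_nonneg (Nat.cast_nonneg _) (D_nonneg h0 t)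
    have h3 : t ≤ tn * (1 + y / b) := by
      have := hD t ht0 htp
      have h4 : t / tn ≤ 1 + y / b := by
        rw [← sub_le_iff_le_add', le_div_iff₀ hb]; linarith
      rw [div_le_iff₀ htn] at h4; linarith
    have h5 : (1 + y / b) * Real.exp (-(μ 0 * y)) ≤
        (1 + 2 / (μ 0 * b)) * Real.exp (-(μ 0 / 2 * y)) := by
      have e1 := ineq1 (x := y) hp
      have e2 : Real.exp (-(μ 0 * y)) ≤ Real.exp (-(μ 0 / 2 * y)) := by
        apply Real.exp_le_exp.mpr; nlinarith
      calc (1 + y / b) * Real.exp (-(μ 0 * y))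
          = Real.exp (-(μ 0 * y)) + (y * Real.exp (-(μ 0 * y))) / b := by ring
        _ ≤ Real.exp (-(μ 0 / 2 * y)) + (2 / μ 0 * Real.exp (-(μ 0 / 2 * y))) / b := by gcongr
        _ = _ := by field_simp
    calc ‖phi μ t‖ ^ n * ‖Complex.exp (((x * t : ℝ) : ℂ) * Complex.I) - 1‖
        ≤ Real.exp (-(μ 0 * y)) * (|x| * (tn * (1 + y / b))) := by
          gcongr
          exact h1.trans (by gcongr)
      _ = |x| * tn * ((1 + y / b) * Real.exp (-(μ 0 * y))) := by ring
      _ ≤ |x| * tn * ((1 + 2 / (μ 0 * b)) * Real.exp (-(μ 0 / 2 * y))) := by gcongr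
      _ = _ := by ring
  · exact (int_re_cont hμ h0 n x).intervalIntegrable _ _
  · exact (int_re_cont hμ h0 n 0).intervalIntegrable _ _

theorem q_zero_eq {μ : ℕ → ℝ} (hμ : HasSum μ 1) (h0 : ∀ k, 0 ≤ μ k) (n : ℕ) :
    Real.pi * q μ n 0 =
      ∫ t in (0 : ℝ)..Real.pi, (phi μ t ^ n * Complex.exp ((0 : ℂ) * t * Complex.I)).re := by
  rw [q_eq hμ.summable h0]; simp

theorem q_reg {μ : ℕ → ℝ} (hμ : HasSum μ 1) (h0 : ∀ k, 0 ≤ μ k) (hp : 0 < μ 0) (n : ℕ)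
    {tn b : ℝ} (htn : 0 < tn) (hb : 0 < b)
    (hD : ∀ t, 0 ≤ t → t ≤ Real.pi → b * (t / tn - 1) ≤ n * D μ t) (k : ℕ) :
    Real.pi * |q μ n k - q μ n 0| ≤ k * tn * (1 + 2 / (μ 0 * b)) * G μ n := by
  have h := space_reg hμ h0 hp n htn hb hD k
  rw [← q_zero_eq hμ h0] at h
  push_cast at h
  rw [← q_eq hμ.summable h0, ← mul_sub, abs_mul, abs_of_pos Real.pi_pos, Nat.abs_cast] at h
  exact h

theorem pw_reg {μ : ℕ → ℝ} (hμ : HasSum μ 1) (h0 : ∀ k, 0 ≤ μ k) (hp : 0 < μ 0) (n : ℕ)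
    {tn b : ℝ} (htn : 0 < tn) (hb : 0 < b)
    (hD : ∀ t, 0 ≤ t → t ≤ Real.pi → b * (t / tn - 1) ≤ n * D μ t) (k : ℕ) :
    Real.pi * |pw μ n (n + k) - q μ n 0| ≤ k * tn * (1 + 2 / (μ 0 * b)) * G μ n := by
  have h := space_reg hμ h0 hp n htn hb hD (-k)
  rw [← q_zero_eq hμ h0] at h
  push_cast at h
  simp only [neg_mul] at h
  rw [← pwp_eq hμ.summable h0, ← mul_sub, abs_mul, abs_of_pos Real.pi_pos, abs_neg,
    Nat.abs_cast] at h
  exact h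

theorem time_reg {μ : ℕ → ℝ} (hμ : HasSum μ 1) (h0 : ∀ k, 0 ≤ μ k) (hp : 0 < μ 0) {C : ℝ}
    (hC : 0 ≤ C)
    (hA : ∀ t, 0 ≤ t → t ≤ Real.pi → ‖1 - phi μ t‖ ≤ C * D μ t) (n i : ℕ) (hn : 1 ≤ n) :
    Real.pi * |q μ (n + i) 0 - q μ n 0| ≤ i * C * (2 / μ 0) / n * G μ n := by
  have hn0 : (0 : ℝ) < n := by exact_mod_cast hn
  rw [← abs_of_pos Real.pi_pos, ← abs_mul, mul_sub, q_zero_eq hμ h0,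
    q_zero_eq hμ h0, ← intervalIntegral.integral_sub]
  · apply int_bound hμ h0
    intro t ht0 htp
    rw [← Complex.sub_re, zero_mul, zero_mul, Complex.exp_zero, mul_one, mul_one]
    refine (Complex.abs_re_le_norm _).trans ?_
    have hle1 : ‖phi μ t‖ ≤ 1 := by
      have := norm_phi_pow_le hμ h0 t 1
      rw [pow_one] at this
      refine this.trans ?_
      rw [Real.exp_le_one_iff]
      have := mul_nonneg (h0 0) (mul_nonneg (Nat.cast_nonneg (α := ℝ) 1) (D_nonneg h0 t))
      linarith
    have h1 : ‖phi μ t ^ i - 1‖ ≤ i * ‖1 - phi μ t‖ := by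
      induction i with
      | zero => simp
      | succ i ih =>
        have : phi μ t ^ (i + 1) - 1 = phi μ t * (phi μ t ^ i - 1) - (1 - phi μ t) := by ring
        rw [this]
        refine (norm_sub_le _ _).trans ?_
        rw [norm_mul]
        have := mul_le_mul hle1 ih (norm_nonneg _) zero_le_one
        push_cast
        linarith
    rw [pow_add, ← mul_sub_one, norm_mul, norm_pow]
    have h2 := norm_phi_pow_le hμ h0 t n
    have e1 := ineq1 (x := n * D μ t) hp
    calc ‖phi μ t‖ ^ n * ‖phi μ t ^ i - 1‖
        ≤ Real.exp (-(μ 0 * (n * D μ t))) * (i * (C * D μ t)) := by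
          gcongr
          exact h1.trans (by gcongr; exact hA t ht0 htp)
      _ = i * C / n * ((n * D μ t) * Real.exp (-(μ 0 * (n * D μ t)))) := by field_simp
      _ ≤ i * C / n * (2 / μ 0 * Real.exp (-(μ 0 / 2 * (n * D μ t)))) := by gcongr
      _ = _ := by ring
  · simpa using (int_re_cont hμ h0 (n + i) 0).intervalIntegrable _ _
  · simpa using (int_re_cont hμ h0 n 0).intervalIntegrable _ _

theorem G_le {μ : ℕ → ℝ} (hμ : HasSum μ 1) (h0 : ∀ k, 0 ≤ μ k) (hp : 0 < μ 0) (n : ℕ)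
    {tn b : ℝ} (htn : 0 < tn) (hb : 0 < b)
    (hD : ∀ t, 0 ≤ t → t ≤ Real.pi → b * (t / tn - 1) ≤ n * D μ t) :
    G μ n ≤ Real.exp (μ 0 / 2 * b) * (2 / (μ 0 * b)) * tn := by
  set l : ℝ := μ 0 / 2 * b / tn with hl
  have hl0 : 0 < l := by positivity
  have h1 : G μ n ≤ ∫ t in (0 : ℝ)..Real.pi, Real.exp (μ 0 / 2 * b) * Real.exp (-l * t) := by
    unfold G
    apply intervalIntegral.integral_mono_on Real.pi_pos.le
    · apply Continuous.intervalIntegrable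
      have := continuous_D hμ.summable h0
      fun_prop
    · apply Continuous.intervalIntegrable
      fun_prop
    · intro t ht
      rw [← Real.exp_add]
      apply Real.exp_le_exp.mpr
      have := hD t ht.1 ht.2
      have h2 : μ 0 / 2 * (b * (t / tn - 1)) ≤ μ 0 / 2 * (n * D μ t) := by gcongr
      have h3 : μ 0 / 2 * (b * (t / tn - 1)) = l * t - μ 0 / 2 * b := by rw [hl]; ring
      linarith
  refine h1.trans ?_
  rw [intervalIntegral.integral_const_mul, mul_assoc]
  gcongr
  rw [intervalIntegral.integral_comp_mul_left (fun x => Real.exp x) (neg_ne_zero.mpr hl0.ne')]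
  rw [integral_exp, mul_zero, Real.exp_zero, smul_eq_mul]
  have h4 := Real.exp_pos (-l * Real.pi)
  have e : 2 / (μ 0 * b) * tn = l⁻¹ := by rw [hl]; field_simp
  rw [e, inv_neg]
  have : 0 < l⁻¹ := by positivity
  nlinarith

end PlaneTree

namespace PlaneTree

theorem hs_congr {f g : ℕ → ℝ} {a : ℝ} (h : ∀ n, f n = g n) : HasSum f a ↔ HasSum g a := by
  rw [funext h]

theorem norm_phi_le_one {μ : ℕ → ℝ} (hμ : HasSum μ 1) (h0 : ∀ k, 0 ≤ μ k) (t : ℝ) :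
    ‖phi μ t‖ ≤ 1 := by
  have := norm_phi_pow_le hμ h0 t 1
  rw [pow_one] at this
  refine this.trans ?_
  rw [Real.exp_le_one_iff]
  have := mul_nonneg (h0 0) (mul_nonneg (Nat.cast_nonneg (α := ℝ) 1) (D_nonneg h0 t))
  linarith

theorem green {μ : ℕ → ℝ} (hμ : HasSum μ 1) (h0 : ∀ k, 0 ≤ μ k) {r : ℝ} (hr0 : 0 ≤ r)
    (hr1 : r < 1) :
    HasSum (fun n : ℕ => r ^ n * (Real.pi * q μ n 0))
      (∫ t in (0 : ℝ)..Real.pi, ((1 - r * phi μ t)⁻¹).re) := by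
  have hφ := continuous_phi hμ.summable h0
  have hint := intervalIntegral.hasSum_integral_of_dominated_convergence
    (μ := MeasureTheory.volume) (a := 0) (b := Real.pi)
    (F := fun (n : ℕ) (t : ℝ) => r ^ n * (phi μ t ^ n * Complex.exp ((0 : ℂ) * t * Complex.I)).re)
    (f := fun t => ((1 - r * phi μ t)⁻¹).re)
    (fun n _ => r ^ n)
    (fun n => by
      apply Continuous.aestronglyMeasurable
      exact continuous_const.mul (int_re_cont hμ h0 n 0))
    (fun n => by
      refine Filter.Eventually.of_forall fun t _ => ?_
      rw [norm_mul, Real.norm_of_nonneg (pow_nonneg hr0 n)]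
      refine mul_le_of_le_one_right (pow_nonneg hr0 n) ?_
      refine (Complex.abs_re_le_norm _).trans ?_
      rw [zero_mul, zero_mul, Complex.exp_zero, mul_one, norm_pow]
      exact pow_le_one₀ (norm_nonneg _) (norm_phi_le_one hμ h0 t))
    (Filter.Eventually.of_forall fun t _ => summable_geometric_of_lt_one hr0 hr1)
    (by simp)
    (Filter.Eventually.of_forall fun t _ => by
      have hlt : ‖(r : ℂ) * phi μ t‖ < 1 := by
        rw [norm_mul, Complex.norm_real, Real.norm_of_nonneg hr0]
        have := norm_phi_le_one hμ h0 t
        nlinarith [norm_nonneg (phi μ t)]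
      have h1 := Complex.hasSum_re (hasSum_geometric_of_norm_lt_one hlt)
      refine (hs_congr fun n => ?_).mp h1
      rw [zero_mul, zero_mul, Complex.exp_zero, mul_one, mul_pow, ← Complex.ofReal_pow,
        Complex.re_ofReal_mul])
  refine (hs_congr fun n => ?_).mp hint
  rw [intervalIntegral.integral_const_mul, q_zero_eq hμ h0]

theorem green_lower {μ : ℕ → ℝ} (hμ : HasSum μ 1) (h0 : ∀ k, 0 ≤ μ k) {C s : ℝ} (hC : 0 ≤ C)
    (hs0 : 0 < s) (hsp : s ≤ Real.pi) (M : ℕ) (hM : 1 ≤ M)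
    (h : ∀ t, 0 ≤ t → t ≤ s → ‖1 - phi μ t‖ ≤ C / M) :
    s * (M / (1 + C) ^ 2) ≤ ∫ t in (0 : ℝ)..Real.pi, ((1 - (1 - 1 / (M : ℝ) : ℝ) * phi μ t)⁻¹).re := by
  have hM0 : (0 : ℝ) < M := by exact_mod_cast hM
  set r : ℝ := 1 - 1 / (M : ℝ) with hr
  have hr0 : 0 ≤ r := by
    rw [hr, sub_nonneg, div_le_one hM0]; exact_mod_cast hM
  have hr1 : r < 1 := by
    rw [hr]; have : 0 < 1 / (M : ℝ) := by positivity
    linarith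
  have hφ := continuous_phi hμ.summable h0
  have hwre : ∀ t, 1 / (M : ℝ) ≤ (1 - r * phi μ t).re := by
    intro t
    rw [Complex.sub_re, Complex.one_re, Complex.re_ofReal_mul]
    have h1 : (phi μ t).re ≤ 1 := (Complex.re_le_norm _).trans (norm_phi_le_one hμ h0 t)
    have : r * (phi μ t).re ≤ r * 1 := by gcongr
    linarith
  have hM1 : 0 < 1 / (M : ℝ) := by positivity
  have hne : ∀ t, 1 - r * phi μ t ≠ 0 := by
    intro t h1
    have := hwre t
    rw [h1, Complex.zero_re] at this
    linarith
  have hcont : Continuous fun t : ℝ => ((1 - r * phi μ t)⁻¹).re := by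
    apply Complex.continuous_re.comp
    exact Continuous.inv₀ (by fun_prop) hne
  have hnn : ∀ t, 0 ≤ ((1 - r * phi μ t)⁻¹).re := by
    intro t
    rw [Complex.inv_re]
    exact div_nonneg (hM1.le.trans (hwre t)) (Complex.normSq_nonneg _)
  rw [← intervalIntegral.integral_add_adjacent_intervals (b := s) (hcont.intervalIntegrable _ _)
    (hcont.intervalIntegrable _ _)]
  have h2 : 0 ≤ ∫ t in s..Real.pi, ((1 - r * phi μ t)⁻¹).re :=
    intervalIntegral.integral_nonneg hsp fun t _ => hnn t
  have h3 : ∫ t in (0 : ℝ)..s, (M / (1 + C) ^ 2 : ℝ) ≤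
      ∫ t in (0 : ℝ)..s, ((1 - r * phi μ t)⁻¹).re := by
    apply intervalIntegral.integral_mono_on hs0.le (by simp) (hcont.intervalIntegrable _ _)
    intro t ht
    rw [Complex.inv_re]
    have hn : ‖1 - r * phi μ t‖ ≤ (1 + C) / M := by
      have e : 1 - r * phi μ t = ((1 / (M : ℝ) : ℝ) : ℂ) + r * (1 - phi μ t) := by
        rw [hr]; push_cast; ring
      rw [e]
      refine (norm_add_le _ _).trans ?_
      rw [norm_mul, Complex.norm_real, Complex.norm_real, Real.norm_of_nonneg hM1.le,
        Real.norm_of_nonneg hr0]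
      have h4 := h t ht.1 ht.2
      have h5 : r * ‖1 - phi μ t‖ ≤ 1 * (C / M) := by gcongr
      rw [add_div]; linarith
    have hsq : Complex.normSq (1 - r * phi μ t) ≤ ((1 + C) / M) ^ 2 := by
      rw [Complex.normSq_eq_norm_sq]; gcongr
    have hpos : 0 < Complex.normSq (1 - r * phi μ t) := Complex.normSq_pos.mpr (hne t)
    calc (M / (1 + C) ^ 2 : ℝ) = (1 / M) / ((1 + C) / M) ^ 2 := by field_simp
      _ ≤ (1 / M) / Complex.normSq (1 - r * phi μ t) := by gcongr
      _ ≤ _ := by gcongr; exact hwre t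
  rw [intervalIntegral.integral_const, sub_zero, smul_eq_mul] at h3
  linarith

set_option maxHeartbeats 2000000 in
theorem core {μ : ℕ → ℝ} (hμ : HasSum μ 1) (h0 : ∀ k, 0 ≤ μ k) (hp : 0 < μ 0)
    (hpos : ∀ t, 0 < t → t ≤ Real.pi → 0 < D μ t)
    (hA : ∃ C : ℝ, ∀ t, 0 ≤ t → t ≤ Real.pi → ‖1 - phi μ t‖ ≤ C * D μ t)
    (hB : ∃ c : ℝ, 0 < c ∧ ∃ γ : ℝ, 1 < γ ∧ ∀ t t', 0 < t → t ≤ t' → t' ≤ Real.pi →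
      c * (t' / t) ^ γ * D μ t ≤ D μ t') :
    (∃ C : ℝ, ∀ᶠ n : ℕ in atTop, 0 < q μ n 0 ∧ ∀ k, q μ n k ≤ C * q μ n 0) ∧
      ∀ k, Tendsto (fun n => q μ n k / q μ n 0) atTop (nhds 1) := by
  obtain ⟨CA', hA'⟩ := hA
  obtain ⟨c, hc, γ, hγ, hB⟩ := hB
  have hcont := continuous_D hμ.summable h0
  have hD0 : D μ 0 = 0 := by simp [D]
  set d := D μ Real.pi with hd
  have hd0 : 0 < d := hpos _ Real.pi_pos le_rfl
  have hc1 : c ≤ 1 := by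
    have := hB Real.pi Real.pi Real.pi_pos le_rfl le_rfl
    rw [div_self Real.pi_pos.ne', Real.one_rpow, mul_one] at this
    nlinarith
  obtain ⟨CA, hCA0, hA⟩ : ∃ CA : ℝ, 0 ≤ CA ∧
      ∀ t, 0 ≤ t → t ≤ Real.pi → ‖1 - phi μ t‖ ≤ CA * D μ t :=
    ⟨max CA' 0, le_max_right _ _, fun t h1 h2 => (hA' t h1 h2).trans
      (mul_le_mul_of_nonneg_right (le_max_left _ _) (D_nonneg h0 t))⟩
  have hex : ∀ n : ℕ, 1 ≤ n → ∃ t : ℝ, 0 < t ∧ t ≤ Real.pi ∧ n * D μ t = d := by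
    intro n hn
    have hn0 : (0 : ℝ) < n := by exact_mod_cast hn
    have hmem : d / n ∈ Icc (D μ 0) (D μ Real.pi) := by
      rw [hD0]
      refine ⟨by positivity, div_le_self hd0.le (by exact_mod_cast hn)⟩
    obtain ⟨t, ht, hte⟩ := intermediate_value_Icc Real.pi_pos.le hcont.continuousOn hmem
    refine ⟨t, lt_of_le_of_ne ht.1 ?_, ht.2, by rw [hte]; field_simp⟩
    rintro rfl
    rw [hD0] at hte
    have : 0 < d / n := by positivity
    linarith
  choose! t ht0 htp htD using hex
  have hDt : ∀ n : ℕ, 1 ≤ n → D μ (t n) = d / n := by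
    intro n hn
    have hn0 : (0 : ℝ) < n := by exact_mod_cast hn
    rw [eq_div_iff hn0.ne', mul_comm]; exact htD n hn
  set b := c * d with hb
  have hb0 : 0 < b := by positivity
  have hDb : ∀ n : ℕ, 1 ≤ n → ∀ s, 0 ≤ s → s ≤ Real.pi → b * (s / t n - 1) ≤ n * D μ s := by
    intro n hn s hs0 hsp
    have hn0 : (0 : ℝ) < n := by exact_mod_cast hn
    have htn := ht0 n hn
    rcases le_total s (t n) with h | h
    · have h1 : s / t n ≤ 1 := (div_le_one htn).mpr h
      have h2 : 0 ≤ n * D μ s := mul_nonneg hn0.le (D_nonneg h0 s)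
      nlinarith
    · have h1 := hB (t n) s htn h hsp
      have h2 : 1 ≤ s / t n := (one_le_div htn).mpr h
      have h3 : s / t n ≤ (s / t n) ^ γ := Real.self_le_rpow_of_one_le h2 hγ.le
      rw [hDt n hn] at h1
      calc b * (s / t n - 1) ≤ b * (s / t n) ^ γ := by gcongr; linarith
        _ = n * (c * (s / t n) ^ γ * (d / n)) := by rw [hb]; field_simp
        _ ≤ _ := by gcongr
  -- constants
  set C0 := Real.exp (μ 0 / 2 * b) * (2 / (μ 0 * b)) with hC0
  have hC00 : 0 < C0 := by positivity
  set C1 := (1 + 2 / (μ 0 * b)) * C0 with hC1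
  have hC10 : 0 < C1 := by positivity
  set C2 := CA * (2 / μ 0) * C0 with hC2
  have hC20 : 0 ≤ C2 := by positivity
  set C := 1 + 1 / c + C0 + C1 + C2 with hC
  have hinvc : 0 < 1 / c := by positivity
  have hG : ∀ n : ℕ, 1 ≤ n → G μ n ≤ C0 * t n := fun n hn =>
    G_le hμ h0 hp n (ht0 n hn) hb0 (hDb n hn)
  have hpi1 : (1 : ℝ) ≤ Real.pi := by linarith [Real.pi_gt_three]
  have dropPi : ∀ x y : ℝ, 0 ≤ x → Real.pi * x ≤ y → x ≤ y := by
    intro x y hx h; nlinarith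
  have hqnn : ∀ n k, 0 ≤ q μ n k := by
    intro n k; unfold q; split_ifs
    · exact pw_nonneg h0 _ _
    · exact le_rfl
  have hup : ∀ n k, 1 ≤ n → q μ n k ≤ C * t n := by
    intro n k hn
    refine (dropPi _ _ (hqnn n k) (q_le_G hμ h0 n k)).trans ((hG n hn).trans ?_)
    have := ht0 n hn
    gcongr; linarith
  have hregq : ∀ n (k : ℕ), 1 ≤ n → |q μ n k - q μ n 0| ≤ C * k * t n ^ 2 := by
    intro n k hn
    have htn := ht0 n hn
    refine (dropPi _ _ (abs_nonneg _) (q_reg hμ h0 hp n htn hb0 (hDb n hn) k)).trans ?_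
    calc (k : ℝ) * t n * (1 + 2 / (μ 0 * b)) * G μ n
        ≤ (k : ℝ) * t n * (1 + 2 / (μ 0 * b)) * (C0 * t n) := by gcongr; exact hG n hn
      _ = C1 * k * t n ^ 2 := by rw [hC1]; ring
      _ ≤ _ := by gcongr; linarith
  have hregp : ∀ n (k : ℕ), 1 ≤ n → |pw μ n (n + k) - q μ n 0| ≤ C * k * t n ^ 2 := by
    intro n k hn
    have htn := ht0 n hn
    refine (dropPi _ _ (abs_nonneg _) (pw_reg hμ h0 hp n htn hb0 (hDb n hn) k)).trans ?_
    calc (k : ℝ) * t n * (1 + 2 / (μ 0 * b)) * G μ n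
        ≤ (k : ℝ) * t n * (1 + 2 / (μ 0 * b)) * (C0 * t n) := by gcongr; exact hG n hn
      _ = C1 * k * t n ^ 2 := by rw [hC1]; ring
      _ ≤ _ := by gcongr; linarith
  have htime : ∀ n i : ℕ, 1 ≤ n → q μ n 0 - C * i * (t n / n) ≤ q μ (n + i) 0 := by
    intro n i hn
    have htn := ht0 n hn
    have hn0 : (0 : ℝ) < n := by exact_mod_cast hn
    have h1 := dropPi _ _ (abs_nonneg _) (time_reg hμ h0 hp hCA0 hA n i hn)
    have h2 : i * CA * (2 / μ 0) / n * G μ n ≤ C * i * (t n / n) := by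
      calc i * CA * (2 / μ 0) / n * G μ n ≤ i * CA * (2 / μ 0) / n * (C0 * t n) := by
            gcongr; exact hG n hn
        _ = C2 * i * (t n / n) := by rw [hC2]; ring
        _ ≤ _ := by gcongr; linarith
    have h3 := (abs_le.mp (h1.trans h2)).1
    linarith
  have hmono : ∀ n m, 1 ≤ n → n ≤ m → t m ≤ C * t n := by
    intro n m hn hnm
    have hm : 1 ≤ m := hn.trans hnm
    have htn := ht0 n hn
    have htm := ht0 m hm
    have hn0 : (0 : ℝ) < n := by exact_mod_cast hn
    have hm0 : (0 : ℝ) < m := by exact_mod_cast hm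
    have hnm' : (n : ℝ) ≤ m := by exact_mod_cast hnm
    rcases le_total (t m) (t n) with h | h
    · nlinarith
    · have h1 := hB (t n) (t m) htn h (htp m hm)
      rw [hDt n hn, hDt m hm] at h1
      have h2 : 1 ≤ t m / t n := (one_le_div htn).mpr h
      have h3 : t m / t n ≤ (t m / t n) ^ γ := Real.self_le_rpow_of_one_le h2 hγ.le
      have h4 : c * (t m / t n) ^ γ ≤ 1 := by
        have e1 : d / m ≤ d / n := by gcongr
        have e2 : 0 < d / n := by positivity
        nlinarith
      have h5 : t m / t n ≤ 1 / c := by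
        rw [le_div_iff₀ hc]; nlinarith
      rw [div_le_iff₀ htn] at h5
      refine h5.trans ?_
      gcongr; linarith
  have hγ0 : 0 < γ := by linarith
  have hgrow : ∀ n m : ℕ, 1 ≤ n → n ≤ m → t n ≤ C * ((m : ℝ) / n) ^ (1 / γ) * t m := by
    intro n m hn hnm
    have hm : 1 ≤ m := hn.trans hnm
    have htn := ht0 n hn
    have htm := ht0 m hm
    have hn0 : (0 : ℝ) < n := by exact_mod_cast hn
    have hm0 : (0 : ℝ) < m := by exact_mod_cast hm
    have hnm' : (1 : ℝ) ≤ m / n := (one_le_div hn0).mpr (by exact_mod_cast hnm)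
    have hr1 : 1 ≤ ((m : ℝ) / n) ^ (1 / γ) := Real.one_le_rpow hnm' (by positivity)
    rcases le_total (t n) (t m) with h | h
    · have : 1 ≤ C * ((m : ℝ) / n) ^ (1 / γ) := by nlinarith
      nlinarith
    · have h1 := hB (t m) (t n) htm h (htp n hn)
      rw [hDt n hn, hDt m hm] at h1
      have h4 : (t n / t m) ^ γ ≤ 1 / c * (m / n) := by
        have e : c * (t n / t m) ^ γ * (d / m) * (m / (c * d)) ≤ d / n * (m / (c * d)) := by gcongr
        calc (t n / t m) ^ γ = c * (t n / t m) ^ γ * (d / m) * (m / (c * d)) := by field_simp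
          _ ≤ d / n * (m / (c * d)) := e
          _ = _ := by field_simp
      have h5 : t n / t m ≤ (1 / c * (m / n)) ^ (1 / γ) := by
        have e := Real.rpow_le_rpow (by positivity) h4 (by positivity : 0 ≤ 1 / γ)
        rwa [← Real.rpow_mul (by positivity), mul_one_div_cancel hγ0.ne', Real.rpow_one] at e
      rw [Real.mul_rpow (by positivity) (by positivity)] at h5
      have h6 : (1 / c) ^ (1 / γ) ≤ 1 / c := by
        have h7 : 1 ≤ 1 / c := (one_le_div hc).mpr hc1
        calc (1 / c) ^ (1 / γ) ≤ (1 / c) ^ (1 : ℝ) :=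
              Real.rpow_le_rpow_of_exponent_le h7 (by rw [div_le_one hγ0]; exact hγ.le)
          _ = _ := Real.rpow_one _
      rw [div_le_iff₀ htm] at h5
      refine h5.trans ?_
      gcongr
      linarith
  have hC1' : 1 ≤ C := by linarith
  have hu0 : q μ 0 0 ≤ 1 := by simp [q, pw]
  set C4 := CA * (d / c) with hC4
  have hC40 : 0 ≤ C4 := by positivity
  have hgreen : ∀ M : ℕ, 1 ≤ M → t M * (M / (1 + C4) ^ 2) ≤
      ∫ t in (0 : ℝ)..Real.pi, ((1 - (1 - 1 / (M : ℝ) : ℝ) * phi μ t)⁻¹).re := by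
    intro M hM
    have hM0 : (0 : ℝ) < M := by exact_mod_cast hM
    apply green_lower hμ h0 hC40 (ht0 M hM) (htp M hM) M hM
    intro s hs hst
    refine (hA s hs (hst.trans (htp M hM))).trans ?_
    rw [hC4, mul_div_assoc]
    gcongr
    rcases hs.eq_or_lt with h | h
    · rw [← h, hD0]; positivity
    · have h1 := hB s (t M) h hst (htp M hM)
      rw [hDt M hM] at h1
      have h2 : 1 ≤ (t M / s) ^ γ := Real.one_le_rpow ((one_le_div h).mpr hst) hγ0.le
      have h3 : c * 1 * D μ s ≤ d / M := by
        refine le_trans ?_ h1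
        have := D_nonneg h0 s
        gcongr
      rw [div_div, le_div_iff₀ (by positivity)]
      rw [le_div_iff₀ hM0] at h3
      linarith
  have hgs : ∀ M : ℕ, 1 ≤ M → HasSum (fun n : ℕ => (1 - 1 / (M : ℝ)) ^ n * (Real.pi * q μ n 0))
      (∫ t in (0 : ℝ)..Real.pi, ((1 - (1 - 1 / (M : ℝ) : ℝ) * phi μ t)⁻¹).re) := by
    intro M hM
    have hM0 : (0 : ℝ) < M := by exact_mod_cast hM
    apply green hμ h0
    · rw [sub_nonneg, div_le_one hM0]; exact_mod_cast hM
    · have : 0 < 1 / (M : ℝ) := by positivity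
      linarith
  have hgs' : ∀ M : ℕ, 1 ≤ M → HasSum (fun n : ℕ => (1 - 1 / (M : ℝ)) ^ n * q μ n 0)
      ((∫ t in (0 : ℝ)..Real.pi, ((1 - (1 - 1 / (M : ℝ) : ℝ) * phi μ t)⁻¹).re) / Real.pi) := by
    intro M hM
    have := (hgs M hM).div_const Real.pi
    refine (hs_congr fun n => ?_).mp this
    field_simp
  have hgood := good_exists (u := fun n => q μ n 0) (t := t) (C := C) (θ := 1 / γ)
    (c1 := 1 / (1 + C4) ^ 2 / Real.pi) hC1' (by positivity) (by rw [div_lt_one hγ0]; exact hγ)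
    (by positivity) ht0 (fun n => hqnn n 0) hu0 (fun n hn => hup n 0 hn) hmono hgrow
    (fun M hM => (hgs' M hM).summable) (by
      intro M hM
      rw [(hgs' M hM).tsum_eq, le_div_iff₀ Real.pi_pos]
      refine le_trans (le_of_eq ?_) (hgreen M hM)
      field_simp)
  obtain ⟨c5, hc5, hlow⟩ := lower_all hC1' ht0 hmono htime
    (fun c hc => comb_lower (f := fun n z => q μ n z) (g := fun n z => pw μ n (n + z))
      hC1' ht0 hmono
      (fun n z hn => by have := (abs_le.mp (hregq n z hn)).1; linarith)
      (fun n z hn => by have := (abs_le.mp (hregp n z hn)).1; linarith)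
      (fun n m Z => conv_lower h0 n m Z) hc) hgood
  constructor
  · refine ⟨C / c5, ?_⟩
    filter_upwards [hlow, eventually_ge_atTop 1] with n hn hn1
    have htn := ht0 n hn1
    refine ⟨lt_of_lt_of_le (by positivity) hn, fun k => (hup n k hn1).trans ?_⟩
    rw [div_mul_eq_mul_div, le_div_iff₀ hc5, mul_assoc]
    have : 0 < C := by linarith
    gcongr
    linarith
  · intro k
    -- t n → 0
    have htend : Tendsto t atTop (nhds 0) := by
      rw [Metric.tendsto_atTop]
      intro ε hε
      set e := min ε Real.pi with he
      have he0 : 0 < e := lt_min hε Real.pi_pos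
      have hDe := hpos e he0 (min_le_right _ _)
      obtain ⟨N, hN⟩ := exists_nat_gt (d / (c * D μ e))
      refine ⟨N + 1, fun n hn => ?_⟩
      have hn1 : 1 ≤ n := by omega
      have hn0 : (0 : ℝ) < n := by exact_mod_cast hn1
      have htn := ht0 n hn1
      rw [Real.dist_eq, sub_zero, abs_of_pos htn]
      by_contra! hcon
      have hle : e ≤ t n := (min_le_left _ _).trans hcon
      have h1 := hB e (t n) he0 hle (htp n hn1)
      rw [hDt n hn1] at h1
      have h2 : 1 ≤ (t n / e) ^ γ := Real.one_le_rpow ((one_le_div he0).mpr hle) hγ0.le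
      have h3 : c * 1 * D μ e ≤ d / n := by
        refine le_trans ?_ h1
        gcongr
      rw [div_lt_iff₀ (by positivity)] at hN
      rw [le_div_iff₀ hn0] at h3
      have hNn : (N : ℝ) ≤ n := by exact_mod_cast (by omega : N ≤ n)
      have : (N : ℝ) * (c * D μ e) ≤ n * (c * D μ e) := by gcongr
      linarith
    rw [tendsto_iff_norm_sub_tendsto_zero]
    apply squeeze_zero' (g := fun n => C * k / c5 * t n)
    · exact Filter.Eventually.of_forall fun n => norm_nonneg _
    · filter_upwards [hlow, eventually_ge_atTop 1] with n hn hn1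
      have htn := ht0 n hn1
      have hq0 : 0 < q μ n 0 := lt_of_lt_of_le (by positivity) hn
      rw [div_sub_one hq0.ne', norm_div, Real.norm_eq_abs, Real.norm_of_nonneg hq0.le,
        div_le_iff₀ hq0]
      refine (hregq n k hn1).trans ?_
      calc C * k * t n ^ 2 = C * k / c5 * t n * (c5 * t n) := by field_simp
        _ ≤ _ := by gcongr
    · simpa using htend.const_mul (C * k / c5)

end PlaneTree

namespace PlaneTree

theorem D_pos {μ : ℕ → ℝ} (hμ : HasSum μ 1) (h0 : ∀ k, 0 ≤ μ k)
    (haper : ∀ d : ℕ, (∀ i : ℕ, 0 < i → 0 < μ i → d ∣ i) → d = 1) (t : ℝ) (ht0 : 0 < t)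
    (htp : t ≤ Real.pi) : 0 < D μ t := by
  refine lt_of_le_of_ne (D_nonneg h0 t) fun hD => ?_
  have hterm : ∀ k : ℕ, 0 < μ k → ∃ n : ℤ, (n : ℝ) = k * (t / (2 * Real.pi)) := by
    intro k hk
    have hnn : ∀ i : ℕ, 0 ≤ μ i * (1 - Real.cos (i * t)) := fun i =>
      mul_nonneg (h0 i) (by linarith [Real.cos_le_one (i * t)])
    have h1 := (summable_D hμ.summable h0 t).le_tsum k (fun i _ => hnn i)
    have h2 : μ k * (1 - Real.cos (k * t)) ≤ 0 := by
      have : D μ t = ∑' k : ℕ, μ k * (1 - Real.cos (k * t)) := rfl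
      rw [← this, ← hD] at h1; exact h1
    have h3 : Real.cos (k * t) = 1 := by
      have := Real.cos_le_one (k * t)
      nlinarith
    obtain ⟨n, hn⟩ := (Real.cos_eq_one_iff _).mp h3
    refine ⟨n, ?_⟩
    have := Real.pi_pos
    field_simp
    linarith
  set x := t / (2 * Real.pi) with hx
  have hpi := Real.pi_pos
  have hx0 : 0 < x := by positivity
  have hx1 : x < 1 := by
    rw [hx, div_lt_one (by positivity)]; linarith
  let H : AddSubgroup ℤ :=
    { carrier := {i : ℤ | ∃ n : ℤ, (n : ℝ) = i * x}
      zero_mem' := ⟨0, by simp⟩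
      add_mem' := by
        rintro a b ⟨n, hn⟩ ⟨m, hm⟩
        exact ⟨n + m, by push_cast; rw [hn, hm]; ring⟩
      neg_mem' := by
        rintro a ⟨n, hn⟩
        exact ⟨-n, by push_cast; rw [hn]; ring⟩ }
  obtain ⟨a, ha⟩ := Int.subgroup_cyclic H
  have hmem : ∀ i : ℤ, i ∈ H ↔ a ∣ i := by
    intro i
    rw [ha, ← AddSubgroup.zmultiples_eq_closure, Int.mem_zmultiples_iff]
  have hd := haper a.natAbs (by
    intro i _ hi
    have h1 : (i : ℤ) ∈ H := by
      obtain ⟨n, hn⟩ := hterm i hi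
      exact ⟨n, by rw [hn]; simp⟩
    rw [hmem] at h1
    exact Int.natAbs_dvd_natAbs.mpr h1)
  have h1 : (1 : ℤ) ∈ H := by
    rw [hmem]
    exact Int.natAbs_dvd.mp (by rw [hd]; simp)
  obtain ⟨n, hn⟩ := h1
  rw [Int.cast_one, one_mul] at hn
  rw [← hn] at hx0 hx1
  have e1 : 0 < n := by exact_mod_cast hx0
  have e2 : n < 1 := by exact_mod_cast hx1
  omega

theorem D_min {μ : ℕ → ℝ} (hμ : HasSum μ 1) (h0 : ∀ k, 0 ≤ μ k)
    (hpos : ∀ t, 0 < t → t ≤ Real.pi → 0 < D μ t) {δ : ℝ} (hδ : 0 < δ) :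
    ∃ d : ℝ, 0 < d ∧ ∀ t, δ ≤ t → t ≤ Real.pi → d ≤ D μ t := by
  rcases le_or_gt δ Real.pi with h | h
  · obtain ⟨x, hx, hmin⟩ := (isCompact_Icc (a := δ) (b := Real.pi)).exists_isMinOn
      ⟨δ, ⟨le_rfl, h⟩⟩ (continuous_D hμ.summable h0).continuousOn
    exact ⟨D μ x, hpos x (hδ.trans_le hx.1) hx.2, fun t h1 h2 => hmin ⟨h1, h2⟩⟩
  · exact ⟨1, one_pos, fun t h1 h2 => by linarith⟩

/-- Truncated second moment function. -/
def WW (μ : ℕ → ℝ) (t : ℝ) : ℝ := ∑' k : ℕ, μ k * min ((k * t) ^ 2) (k * t)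

theorem summable_W {μ : ℕ → ℝ} (h0 : ∀ k, 0 ≤ μ k)
    (hcrit : HasSum (fun k : ℕ => (k : ℝ) * μ k) 1) {t : ℝ} (ht : 0 ≤ t) :
    Summable fun k : ℕ => μ k * min ((k * t) ^ 2) (k * t) := by
  apply Summable.of_nonneg_of_le _ _ (hcrit.summable.mul_right t)
  · intro k; exact mul_nonneg (h0 k) (by positivity)
  · intro k
    calc μ k * min ((k * t) ^ 2) (k * t) ≤ μ k * (k * t) :=
          mul_le_mul_of_nonneg_left (min_le_right _ _) (h0 k)
      _ = _ := by ring

theorem W_nonneg {μ : ℕ → ℝ} (h0 : ∀ k, 0 ≤ μ k) {t : ℝ} (ht : 0 ≤ t) : 0 ≤ WW μ t :=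
  tsum_nonneg fun k => mul_nonneg (h0 k) (by positivity)

theorem D_le_W {μ : ℕ → ℝ} (hμ : HasSum μ 1) (h0 : ∀ k, 0 ≤ μ k)
    (hcrit : HasSum (fun k : ℕ => (k : ℝ) * μ k) 1) {t : ℝ} (ht : 0 ≤ t) :
    D μ t ≤ 2 * WW μ t := by
  unfold D WW
  rw [← tsum_mul_left]
  apply (summable_D hμ.summable h0 t).tsum_le_tsum _ ((summable_W h0 hcrit ht).mul_left 2)
  intro k
  have hu : 0 ≤ (k : ℝ) * t := by positivity
  set u := (k : ℝ) * t
  have h1 : 1 - Real.cos u ≤ 2 * min (u ^ 2) u := by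
    have h2 := Real.one_sub_sq_div_two_le_cos (x := u)
    have h3 := Real.neg_one_le_cos u
    rcases le_total u 1 with h | h
    · rw [min_eq_left (by nlinarith)]; nlinarith
    · rw [min_eq_right (by nlinarith)]; linarith
  calc μ k * (1 - Real.cos u) ≤ μ k * (2 * min (u ^ 2) u) :=
        mul_le_mul_of_nonneg_left h1 (h0 k)
    _ = _ := by ring

theorem exp_bound (u : ℝ) :
    ‖Complex.exp (u * Complex.I) - 1 - u * Complex.I‖ ≤ 2 * min (u ^ 2) |u| := by
  have hn : ‖(u : ℂ) * Complex.I‖ = |u| := by simp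
  have hb : ‖Complex.exp (u * Complex.I) - 1 - u * Complex.I‖ ≤ 2 * |u| := by
    refine (norm_sub_le _ _).trans ?_
    rw [hn]
    linarith [norm_e_sub_one u]
  rcases le_total |u| 1 with h | h
  · rw [min_eq_left (by rw [← sq_abs]; nlinarith [abs_nonneg u])]
    refine (Complex.norm_exp_sub_one_sub_id_le (by rw [hn]; exact h)).trans ?_
    rw [hn, sq_abs]; nlinarith [sq_nonneg u]
  · rw [min_eq_right (by rw [← sq_abs]; nlinarith [abs_nonneg u])]
    exact hb

theorem phi_sub_le {μ : ℕ → ℝ} (hμ : HasSum μ 1) (h0 : ∀ k, 0 ≤ μ k)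
    (hcrit : HasSum (fun k : ℕ => (k : ℝ) * μ k) 1) {t : ℝ} (ht : 0 ≤ t) :
    ‖1 - phi μ t‖ ≤ 2 * (t ^ 2 + WW μ t) := by
  have hpsi : HasSum (fun k : ℕ => (μ k : ℂ) * Complex.exp (t * Complex.I) ^ k) (psi μ t) :=
    (summable_norm_psi hμ.summable h0 t).of_norm.hasSum
  have h1 := hpsi.mul_left (Complex.exp (-(t * Complex.I)))
  have hμc : HasSum (fun k : ℕ => (μ k : ℂ)) 1 := by
    have := Complex.hasSum_ofReal.mpr hμ
    rwa [Complex.ofReal_one] at this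
  have hcc : HasSum (fun k : ℕ => ((k : ℝ) : ℂ) * (μ k : ℂ)) 1 := by
    have := Complex.hasSum_ofReal.mpr hcrit
    push_cast at this ⊢
    exact this
  have h2 := (h1.sub hμc).sub ((hcc.sub hμc).mul_left (t * Complex.I))
  have e : ∀ k : ℕ, Complex.exp (-(t * Complex.I)) * ((μ k : ℂ) * Complex.exp (t * Complex.I) ^ k)
      - μ k - t * Complex.I * (((k : ℝ) : ℂ) * μ k - μ k) =
      μ k * (Complex.exp (((((k : ℝ) - 1) * t : ℝ) : ℂ) * Complex.I) - 1 -
        ((((k : ℝ) - 1) * t : ℝ) : ℂ) * Complex.I) := by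
    intro k
    have : Complex.exp (((((k : ℝ) - 1) * t : ℝ) : ℂ) * Complex.I) =
        Complex.exp (-(t * Complex.I)) * Complex.exp (t * Complex.I) ^ k := by
      rw [← Complex.exp_nat_mul, ← Complex.exp_add]
      congr 1
      push_cast; ring
    rw [this]
    push_cast
    ring
  have hval : Complex.exp (-(t * Complex.I)) * psi μ t - 1 - t * Complex.I * (1 - 1) =
      -(1 - phi μ t) := by
    unfold phi; ring
  rw [hval] at h2
  have hbound : ∀ k : ℕ, ‖Complex.exp (-(t * Complex.I)) *
      ((μ k : ℂ) * Complex.exp (t * Complex.I) ^ k)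
      - μ k - t * Complex.I * (((k : ℝ) : ℂ) * μ k - μ k)‖ ≤
      2 * (μ k * t ^ 2 + μ k * min ((k * t) ^ 2) (k * t)) := by
    intro k
    rw [e k, norm_mul, Complex.norm_real, Real.norm_of_nonneg (h0 k)]
    have h3 := exp_bound (((k : ℝ) - 1) * t)
    have h4 : min ((((k : ℝ) - 1) * t) ^ 2) |((k : ℝ) - 1) * t| ≤
        t ^ 2 + min ((k * t) ^ 2) (k * t) := by
      rcases Nat.eq_zero_or_pos k with hk | hk
      · subst hk
        refine (min_le_left _ _).trans ?_
        simp
      · have hk1 : (1 : ℝ) ≤ k := by exact_mod_cast hk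
        have h5 : |((k : ℝ) - 1) * t| ≤ k * t := by
          rw [abs_of_nonneg (mul_nonneg (by linarith) ht)]; nlinarith
        have h6 : (((k : ℝ) - 1) * t) ^ 2 ≤ (k * t) ^ 2 := by
          rw [← sq_abs]; gcongr
        have := min_le_min h6 h5
        nlinarith [sq_nonneg t]
    calc μ k * _ ≤ μ k * (2 * (t ^ 2 + min ((k * t) ^ 2) (k * t))) :=
          mul_le_mul_of_nonneg_left (h3.trans (by linarith)) (h0 k)
      _ = _ := by ring
  have hsum : HasSum (fun k : ℕ => 2 * (μ k * t ^ 2 + μ k * min ((k * t) ^ 2) (k * t)))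
      (2 * (1 * t ^ 2 + WW μ t)) :=
    ((hμ.mul_right (t ^ 2)).add (summable_W h0 hcrit ht).hasSum).mul_left 2
  have h7 := tsum_of_norm_bounded hsum hbound
  rw [h2.tsum_eq, norm_neg, one_mul] at h7
  exact h7

theorem verify {μ : ℕ → ℝ} (hμ : HasSum μ 1) (h0 : ∀ k, 0 ≤ μ k)
    (hcrit : HasSum (fun k : ℕ => (k : ℝ) * μ k) 1)
    {F : ℝ → ℝ} {c C c' γ : ℝ} (hc : 0 < c) (hC : 0 < C) (hc' : 0 < c') (hγ : 1 < γ)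
    (hF0 : ∀ t, 0 < t → t ≤ Real.pi → 0 < F t)
    (hF1 : ∀ t, 0 < t → t ≤ Real.pi → c * F t ≤ D μ t)
    (hF2 : ∀ t, 0 < t → t ≤ Real.pi → WW μ t ≤ C * F t)
    (hF3 : ∀ t t', 0 < t → t ≤ t' → t' ≤ Real.pi → c' * (t' / t) ^ γ * F t ≤ F t') :
    (∃ C : ℝ, ∀ t, 0 ≤ t → t ≤ Real.pi → ‖1 - phi μ t‖ ≤ C * D μ t) ∧
    (∃ c : ℝ, 0 < c ∧ ∃ γ : ℝ, 1 < γ ∧ ∀ t t', 0 < t → t ≤ t' → t' ≤ Real.pi →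
      c * (t' / t) ^ γ * D μ t ≤ D μ t') := by
  obtain ⟨k, hk1, hk⟩ : ∃ k : ℕ, 1 ≤ k ∧ 0 < μ k := by
    by_contra! hcon
    have hz : ∀ k : ℕ, (k : ℝ) * μ k = 0 := by
      intro k
      rcases Nat.eq_zero_or_pos k with h | h
      · simp [h]
      · rw [le_antisymm (hcon k h) (h0 k), mul_zero]
    have := hcrit.tsum_eq
    simp [hz] at this
  have htW : ∀ t, 0 ≤ t → t ≤ Real.pi → t ^ 2 ≤ Real.pi / μ k * WW μ t := by
    intro t ht0 htp
    have h1 := (summable_W h0 hcrit ht0).le_tsum k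
      (fun i _ => mul_nonneg (h0 i) (by positivity))
    have hpi := Real.pi_gt_three
    have hk1' : (1 : ℝ) ≤ k := by exact_mod_cast hk1
    have h2 : t ^ 2 / Real.pi ≤ min ((k * t) ^ 2) (k * t) := by
      have hkt : t ≤ k * t := by nlinarith
      apply le_min
      · refine (div_le_self (by positivity) (by linarith)).trans ?_
        gcongr
      · rw [div_le_iff₀ Real.pi_pos]
        nlinarith
    have h3 : μ k * (t ^ 2 / Real.pi) ≤ WW μ t := (mul_le_mul_of_nonneg_left h2 hk.le).trans h1
    calc t ^ 2 = Real.pi / μ k * (μ k * (t ^ 2 / Real.pi)) := by field_simp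
      _ ≤ _ := by gcongr
  constructor
  · refine ⟨2 * (Real.pi / μ k + 1) * C / c, ?_⟩
    intro t ht0 htp
    rcases ht0.eq_or_lt with h | h
    · subst h
      have h1 := phi_sub_le hμ h0 hcrit (le_refl (0 : ℝ))
      have h2 : WW μ 0 = 0 := by simp [WW]
      have h3 : D μ 0 = 0 := by simp [D]
      rw [h2] at h1
      rw [h3]
      simpa using h1
    · have h1 := phi_sub_le hμ h0 hcrit ht0
      have h2 := htW t ht0 htp
      have h3 := hF2 t h htp
      have h4 := hF1 t h htp
      have hpk : 0 < Real.pi / μ k := by positivity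
      calc ‖1 - phi μ t‖ ≤ 2 * (Real.pi / μ k * WW μ t + WW μ t) := by linarith
        _ = 2 * (Real.pi / μ k + 1) * WW μ t := by ring
        _ ≤ 2 * (Real.pi / μ k + 1) * (C * F t) := by gcongr
        _ = 2 * (Real.pi / μ k + 1) * C / c * (c * F t) := by field_simp
        _ ≤ _ := by gcongr
  · refine ⟨c * c' / (2 * C), by positivity, γ, hγ, ?_⟩
    intro t t' ht htt' htp'
    have htp := htt'.trans htp'
    have h1 := D_le_W hμ h0 hcrit ht.le
    have h2 := hF2 t ht htp
    have h3 := hF3 t t' ht htt' htp'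
    have h4 := hF1 t' (ht.trans_le htt') htp'
    have hr : 0 < (t' / t) ^ γ := by
      have : 0 < t' := ht.trans_le htt'
      positivity
    calc c * c' / (2 * C) * (t' / t) ^ γ * D μ t
        ≤ c * c' / (2 * C) * (t' / t) ^ γ * (2 * (C * F t)) := by gcongr; linarith
      _ = c * (c' * (t' / t) ^ γ * F t) := by field_simp
      _ ≤ c * F t' := by gcongr
      _ ≤ _ := h4

theorem one_sub_cos_ge {u : ℝ} (h0 : 0 ≤ u) (h1 : u ≤ Real.pi) :
    2 / Real.pi ^ 2 * u ^ 2 ≤ 1 - Real.cos u := by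
  have h := Real.cos_le_one_sub_mul_cos_sq (x := u) (by rw [abs_of_nonneg h0]; exact h1)
  linarith

theorem finvar {μ : ℕ → ℝ} (hμ : HasSum μ 1) (h0 : ∀ k, 0 ≤ μ k)
    (hcrit : HasSum (fun k : ℕ => (k : ℝ) * μ k) 1)
    (hpos : ∀ t, 0 < t → t ≤ Real.pi → 0 < D μ t)
    (hvar : Summable fun k : ℕ => (k : ℝ) ^ 2 * μ k) :
    (∃ C : ℝ, ∀ t, 0 ≤ t → t ≤ Real.pi → ‖1 - phi μ t‖ ≤ C * D μ t) ∧
    (∃ c : ℝ, 0 < c ∧ ∃ γ : ℝ, 1 < γ ∧ ∀ t t', 0 < t → t ≤ t' → t' ≤ Real.pi →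
      c * (t' / t) ^ γ * D μ t ≤ D μ t') := by
  obtain ⟨k, hk1, hk⟩ : ∃ k : ℕ, 1 ≤ k ∧ 0 < μ k := by
    by_contra! hcon
    have hz : ∀ k : ℕ, (k : ℝ) * μ k = 0 := by
      intro k
      rcases Nat.eq_zero_or_pos k with h | h
      · simp [h]
      · rw [le_antisymm (hcon k h) (h0 k), mul_zero]
    have := hcrit.tsum_eq
    simp [hz] at this
  have hk0 : (0 : ℝ) < k := by exact_mod_cast hk1
  obtain ⟨d, hd0, hd⟩ := D_min hμ h0 hpos (δ := Real.pi / k) (by positivity)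
  have hV : 0 ≤ ∑' k : ℕ, (k : ℝ) ^ 2 * μ k := tsum_nonneg fun k => mul_nonneg (by positivity) (h0 k)
  set c := min (d / Real.pi ^ 2) (μ k * (2 / Real.pi ^ 2 * k ^ 2)) with hc
  have hpi := Real.pi_pos
  have hc0 : 0 < c := lt_min (by positivity) (by positivity)
  refine verify hμ h0 hcrit (F := fun t => t ^ 2) (c := c)
    (C := ∑' k : ℕ, (k : ℝ) ^ 2 * μ k + 1) (c' := 1) (γ := 2) hc0 (by linarith) one_pos
    (by norm_num) (fun t ht _ => by positivity) ?_ ?_ ?_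
  · intro t ht htp
    rcases le_total (Real.pi / k) t with h | h
    · refine le_trans ?_ (hd t h htp)
      calc c * t ^ 2 ≤ d / Real.pi ^ 2 * Real.pi ^ 2 := by
            gcongr; exact min_le_left _ _
        _ = d := by field_simp
    · have h1 := (summable_D hμ.summable h0 t).le_tsum k
        (fun i _ => mul_nonneg (h0 i) (by linarith [Real.cos_le_one (i * t)]))
      refine le_trans ?_ h1
      have h2 := one_sub_cos_ge (u := k * t) (by positivity) (by
        rw [le_div_iff₀ hk0] at h; linarith)
      calc c * t ^ 2 ≤ (μ k * (2 / Real.pi ^ 2 * k ^ 2)) * t ^ 2 := by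
            gcongr; exact min_le_right _ _
        _ = μ k * (2 / Real.pi ^ 2 * (k * t) ^ 2) := by ring
        _ ≤ _ := by gcongr
  · intro t ht htp
    have : WW μ t ≤ ∑' k : ℕ, (k : ℝ) ^ 2 * μ k * t ^ 2 := by
      apply (summable_W h0 hcrit ht.le).tsum_le_tsum _ (hvar.mul_right _)
      intro i
      calc μ i * min ((i * t) ^ 2) (i * t) ≤ μ i * (i * t) ^ 2 :=
            mul_le_mul_of_nonneg_left (min_le_left _ _) (h0 i)
        _ = _ := by ring
    rw [tsum_mul_right] at this
    refine this.trans ?_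
    gcongr; linarith
  · intro t t' ht htt' _
    rw [Real.rpow_two, one_mul, div_pow, div_mul_cancel₀ _ (by positivity)]

end PlaneTree

namespace PlaneTree

theorem ev_mono {V : ℕ → ℝ} (hV : ∀ j, 0 < V j) {J : ℕ} (h : ∀ j, J ≤ j → V (j + 1) ≤ V j) :
    ∃ C : ℝ, 0 < C ∧ ∀ j i, V (j + i) ≤ C * V j := by
  have hm : ∀ j, J ≤ j → ∀ i, V (j + i) ≤ V j := by
    intro j hj i
    induction i with
    | zero => simp
    | succ i ih => exact (h (j + i) (by omega)).trans ih
  set B := ∑ i ∈ Finset.range (J + 1), V i with hB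
  have hBn : ∀ n, V n ≤ B := by
    intro n
    rcases le_total J n with hn | hn
    · obtain ⟨i, rfl⟩ := Nat.exists_eq_add_of_le hn
      refine (hm J le_rfl i).trans ?_
      exact Finset.single_le_sum (f := V) (fun i _ => (hV i).le) (Finset.mem_range.mpr (by omega))
    · exact Finset.single_le_sum (f := V) (fun i _ => (hV i).le) (Finset.mem_range.mpr (by omega))
  have hB0 : 0 < B := (hV 0).trans_le (hBn 0)
  have hs : 0 ≤ ∑ j ∈ Finset.range (J + 1), B / V j :=
    Finset.sum_nonneg fun j _ => div_nonneg hB0.le (hV j).le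
  refine ⟨1 + ∑ j ∈ Finset.range (J + 1), B / V j, by linarith, ?_⟩
  intro j i
  rcases le_total J j with hj | hj
  · have := hm j hj i
    nlinarith [hV j]
  · have h1 : B / V j ≤ ∑ j ∈ Finset.range (J + 1), B / V j :=
      Finset.single_le_sum (f := fun j => B / V j)
        (fun i _ => div_nonneg hB0.le (hV i).le) (Finset.mem_range.mpr (by omega))
    have hVj := hV j
    calc V (j + i) ≤ B := hBn _
      _ = B / V j * V j := by field_simp
      _ ≤ _ := by gcongr; linarith

theorem two_sided_geom {r : ℝ} (hr0 : 0 ≤ r) (hr1 : r < 1) (N j : ℕ) :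
    ∑ i ∈ Finset.range N, r ^ ((i - j) + (j - i)) ≤ 2 * (1 - r)⁻¹ := by
  have hg : ∀ n, ∑ i ∈ Finset.range n, r ^ i ≤ (1 - r)⁻¹ := by
    intro n
    rw [← tsum_geometric_of_lt_one hr0 hr1]
    exact (summable_geometric_of_lt_one hr0 hr1).sum_le_tsum _ (fun i _ => by positivity)
  calc ∑ i ∈ Finset.range N, r ^ ((i - j) + (j - i))
      ≤ ∑ i ∈ Finset.range (j + N), r ^ ((i - j) + (j - i)) := by
        apply Finset.sum_le_sum_of_subset_of_nonneg
        · exact Finset.range_mono (by omega)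
        · intros; positivity
    _ = ∑ i ∈ Finset.range j, r ^ ((i - j) + (j - i)) +
        ∑ i ∈ Finset.range N, r ^ ((j + i - j) + (j - (j + i))) := Finset.sum_range_add _ _ _
    _ ≤ ∑ i ∈ Finset.range j, r ^ (j - 1 - i) + ∑ i ∈ Finset.range N, r ^ i := by
        apply add_le_add
        · refine Finset.sum_le_sum fun i hi => ?_
          rw [Finset.mem_range] at hi
          exact pow_le_pow_of_le_one hr0 hr1.le (by omega)
        · refine Finset.sum_le_sum fun i hi => ?_
          exact pow_le_pow_of_le_one hr0 hr1.le (by omega)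
    _ = ∑ i ∈ Finset.range j, r ^ i + ∑ i ∈ Finset.range N, r ^ i := by
        rw [Finset.sum_range_reflect (fun i => r ^ i)]
    _ ≤ 2 * (1 - r)⁻¹ := by linarith [hg j, hg N]

/-- Tail of a sequence. -/
def tailP (μ : ℕ → ℝ) (n : ℕ) : ℝ := ∑' k : ℕ, {m : ℕ | n ≤ m}.indicator μ k

theorem WW_le {μ : ℕ → ℝ} (hμ : HasSum μ 1) (h0 : ∀ k, 0 ≤ μ k)
    {ρ σ C : ℝ} (hC : 0 < C) (hρ0 : 0 < ρ) (hρ : 2 * ρ < 1) (hσ0 : 0 < σ) (hσ : 1 < 4 * σ)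
    (hTpos : ∀ j, 0 < tailP μ (2 ^ j))
    (hup : ∀ j i, tailP μ (2 ^ (j + i)) ≤ C * ρ ^ i * tailP μ (2 ^ j))
    (hlo : ∀ j i, tailP μ (2 ^ j) * σ ^ i ≤ C * tailP μ (2 ^ (j + i))) :
    ∃ K : ℝ, 0 < K ∧ ∀ t j, 0 < t → t / 4 ≤ (1 / 2) ^ j → WW μ t ≤ K * tailP μ (2 ^ j) := by
  set r := max (2 * ρ) (1 / (4 * σ)) with hr
  have hr0 : 0 ≤ r := le_max_of_le_left (by positivity)
  have hr1 : r < 1 := max_lt hρ (by rw [div_lt_one (by positivity)]; exact hσ)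
  have hr1' : 0 < 1 - r := by linarith
  refine ⟨64 * (C * (2 * (1 - r)⁻¹)), by positivity, ?_⟩
  intro t j ht htj
  set y : ℕ → ℝ := fun i => 2 ^ i * (1 / 2) ^ j with hy
  have hy0 : ∀ i, 0 < y i := fun i => by positivity
  set m : ℕ → ℝ := fun i => min (y i ^ 2) (y i) with hm
  have hm0 : ∀ i, 0 ≤ m i := fun i => le_min (by positivity) (hy0 i).le
  have hTm : ∀ i, tailP μ (2 ^ i) * m i ≤ C * r ^ ((i - j) + (j - i)) * tailP μ (2 ^ j) := by
    intro i
    have hTj := hTpos j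
    have hTi := hTpos i
    rcases le_total j i with h | h
    · obtain ⟨l, rfl⟩ := Nat.exists_eq_add_of_le h
      have e1 : (j + l - j) + (j - (j + l)) = l := by omega
      have e2 : y (j + l) = 2 ^ l := by
        simp only [hy]; rw [pow_add]
        have : (2 : ℝ) ^ j * (1 / 2) ^ j = 1 := by rw [← mul_pow]; norm_num
        linear_combination 2 ^ l * this
      rw [e1]
      calc tailP μ (2 ^ (j + l)) * m (j + l) ≤ (C * ρ ^ l * tailP μ (2 ^ j)) * 2 ^ l := by
            apply mul_le_mul (hup j l) _ (hm0 _) (by positivity)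
            rw [← e2]; exact min_le_right _ _
        _ = C * (2 * ρ) ^ l * tailP μ (2 ^ j) := by rw [mul_pow]; ring
        _ ≤ _ := by
          gcongr
          exact le_max_left _ _
    · obtain ⟨l, rfl⟩ := Nat.exists_eq_add_of_le h
      have e1 : (i - (i + l)) + (i + l - i) = l := by omega
      have e2 : y i ^ 2 = (1 / 4) ^ l := by
        simp only [hy]; rw [pow_add]
        have : (2 : ℝ) ^ i * (1 / 2) ^ i = 1 := by rw [← mul_pow]; norm_num
        rw [← mul_assoc, this, one_mul, ← pow_mul, mul_comm, pow_mul]; norm_num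
      rw [e1]
      have h1 : tailP μ (2 ^ i) ≤ C * tailP μ (2 ^ (i + l)) / σ ^ l := by
        rw [le_div_iff₀ (by positivity)]; exact hlo i l
      calc tailP μ (2 ^ i) * m i ≤ C * tailP μ (2 ^ (i + l)) / σ ^ l * (1 / 4) ^ l := by
            apply mul_le_mul h1 _ (hm0 _) (by positivity)
            rw [← e2]; exact min_le_left _ _
        _ = C * (1 / (4 * σ)) ^ l * tailP μ (2 ^ (i + l)) := by
            rw [div_pow, div_pow, mul_pow, one_pow]; field_simp
        _ ≤ _ := by
          gcongr
          exact le_max_right _ _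
  apply Real.tsum_le_of_sum_range_le
  · intro k; exact mul_nonneg (h0 k) (by positivity)
  intro N
  have hpt : ∀ k ∈ Finset.range N, μ k * min ((k * t) ^ 2) (k * t) ≤
      ∑ i ∈ Finset.range N, 64 * (m i * {n : ℕ | 2 ^ i ≤ n}.indicator μ k) := by
    intro k hk
    rw [Finset.mem_range] at hk
    have hnn : ∀ i ∈ Finset.range N, 0 ≤ 64 * (m i * {n : ℕ | 2 ^ i ≤ n}.indicator μ k) := by
      intro i _
      have : 0 ≤ {n : ℕ | 2 ^ i ≤ n}.indicator μ k := Set.indicator_nonneg (fun x _ => h0 x) k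
      have := hm0 i
      positivity
    rcases Nat.eq_zero_or_pos k with h | h
    · subst h
      refine le_trans (by simp) (Finset.sum_nonneg hnn)
    · have h1 : 2 ^ (Nat.log 2 k) ≤ k := Nat.pow_log_le_self 2 h.ne'
      have h2 : k < 2 ^ (Nat.log 2 k + 1) := Nat.lt_pow_succ_log_self (by norm_num) k
      have h3 : Nat.log 2 k < k := Nat.log_lt_self 2 h.ne'
      set i := Nat.log 2 k
      refine le_trans ?_ (Finset.single_le_sum hnn (Finset.mem_range.mpr (h3.trans hk)))
      rw [Set.indicator_of_mem (by exact h1)]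
      have hkt : (k : ℝ) * t ≤ 8 * y i := by
        have : (k : ℝ) ≤ 2 ^ (i + 1) := by exact_mod_cast h2.le
        calc (k : ℝ) * t ≤ 2 ^ (i + 1) * (4 * (1 / 2) ^ j) := by gcongr; linarith
          _ = _ := by simp only [hy]; ring
      have hkt0 : 0 ≤ (k : ℝ) * t := by positivity
      have : min ((k * t) ^ 2) (k * t) ≤ 64 * m i := by
        rw [hm]
        simp only
        rw [mul_min_of_nonneg _ _ (by norm_num : (0 : ℝ) ≤ 64)]
        apply min_le_min
        · have := pow_le_pow_left₀ hkt0 hkt 2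
          linarith
        · linarith [hy0 i]
      calc μ k * min ((k * t) ^ 2) (k * t) ≤ μ k * (64 * m i) :=
            mul_le_mul_of_nonneg_left this (h0 k)
        _ = _ := by ring
  calc ∑ k ∈ Finset.range N, μ k * min ((k * t) ^ 2) (k * t)
      ≤ ∑ k ∈ Finset.range N, ∑ i ∈ Finset.range N,
        64 * (m i * {n : ℕ | 2 ^ i ≤ n}.indicator μ k) := Finset.sum_le_sum hpt
    _ = ∑ i ∈ Finset.range N, 64 * (m i * ∑ k ∈ Finset.range N,
        {n : ℕ | 2 ^ i ≤ n}.indicator μ k) := by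
        rw [Finset.sum_comm]
        simp only [Finset.mul_sum]
    _ ≤ ∑ i ∈ Finset.range N, 64 * (C * r ^ ((i - j) + (j - i)) * tailP μ (2 ^ j)) := by
        apply Finset.sum_le_sum
        intro i _
        have h1 : ∑ k ∈ Finset.range N, {n : ℕ | 2 ^ i ≤ n}.indicator μ k ≤ tailP μ (2 ^ i) :=
          (hμ.summable.indicator _).sum_le_tsum _
            (fun k _ => Set.indicator_nonneg (fun x _ => h0 x) k)
        have h2 := hTm i
        have h3 := mul_le_mul_of_nonneg_left h1 (hm0 i)
        linarith
    _ = 64 * (C * (∑ i ∈ Finset.range N, r ^ ((i - j) + (j - i)))) * tailP μ (2 ^ j) := by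
        simp only [Finset.mul_sum, Finset.sum_mul]
        exact Finset.sum_congr rfl fun i _ => by ring
    _ ≤ _ := by
        have := two_sided_geom hr0 hr1 N j
        have := hTpos j
        gcongr

theorem D_ge_tail {μ : ℕ → ℝ} (hμ : HasSum μ 1) (h0 : ∀ k, 0 ≤ μ k) (i : ℕ) (t : ℝ)
    (h1 : (1 / 2) ^ (i + 3) < t / 4) (h2 : t / 4 ≤ (1 / 2) ^ (i + 2)) :
    1 / (2 * Real.pi ^ 2) * (tailP μ (2 ^ i) - tailP μ (2 ^ (i + 1))) ≤ D μ t := by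
  unfold tailP D
  have s1 := hμ.summable.indicator {m : ℕ | 2 ^ i ≤ m}
  have s2 := hμ.summable.indicator {m : ℕ | 2 ^ (i + 1) ≤ m}
  rw [← s1.tsum_sub s2, ← tsum_mul_left]
  apply ((s1.sub s2).mul_left _).tsum_le_tsum _ (summable_D hμ.summable h0 t)
  intro k
  have hnn : 0 ≤ μ k * (1 - Real.cos (k * t)) :=
    mul_nonneg (h0 k) (by linarith [Real.cos_le_one (k * t)])
  by_cases hk1 : 2 ^ i ≤ k
  · by_cases hk2 : 2 ^ (i + 1) ≤ k
    · rw [Set.indicator_of_mem (by exact hk1), Set.indicator_of_mem (by exact hk2), sub_self,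
        mul_zero]
      exact hnn
    · rw [Set.indicator_of_mem (by exact hk1), Set.indicator_of_notMem (by exact hk2), sub_zero]
      have ha : (2 : ℝ) ^ i ≤ k := by exact_mod_cast hk1
      have hb : (k : ℝ) ≤ 2 ^ (i + 1) := by exact_mod_cast (not_le.mp hk2).le
      have e : (2 : ℝ) ^ i * (1 / 2) ^ i = 1 := by rw [← mul_pow]; norm_num
      have hp : (0 : ℝ) < (1 / 2) ^ i := by positivity
      rw [pow_succ] at hb
      rw [pow_add] at h1 h2
      have ht : 0 < t := by nlinarith
      have hlow : 1 / 2 ≤ (k : ℝ) * t := by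
        calc (1 : ℝ) / 2 = 2 ^ i * ((1 / 2) ^ i * (1 / 2)) := by rw [← mul_assoc, e, one_mul]
          _ ≤ k * t := by gcongr; linarith
      have hupp : (k : ℝ) * t ≤ 2 := by
        calc (k : ℝ) * t ≤ (2 ^ i * 2) * (1 / 2) ^ i := by gcongr; linarith
          _ = 2 := by linear_combination 2 * e
      have := one_sub_cos_ge (u := k * t) (by linarith) (by linarith [Real.pi_gt_three])
      have hpi := Real.pi_pos
      have h3 : 1 / (2 * Real.pi ^ 2) ≤ 1 - Real.cos (k * t) := by
        refine le_trans ?_ this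
        calc 1 / (2 * Real.pi ^ 2) = 2 / Real.pi ^ 2 * (1 / 2) ^ 2 := by field_simp
          _ ≤ _ := by gcongr
      rw [mul_comm]
      exact mul_le_mul_of_nonneg_left h3 (h0 k)
  · have hk2 : ¬ 2 ^ (i + 1) ≤ k := by rw [pow_succ]; omega
    rw [Set.indicator_of_notMem (by exact hk1), Set.indicator_of_notMem (by exact hk2), sub_self,
        mul_zero]
    exact hnn

theorem tail_anti {μ : ℕ → ℝ} (hμ : HasSum μ 1) (h0 : ∀ k, 0 ≤ μ k) {a b : ℕ} (h : a ≤ b) :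
    tailP μ b ≤ tailP μ a := by
  apply (hμ.summable.indicator _).tsum_le_tsum _ (hμ.summable.indicator _)
  intro k
  exact Set.indicator_le_indicator_of_subset (fun x hx => le_trans h hx) h0 k

theorem tail_le_one {μ : ℕ → ℝ} (hμ : HasSum μ 1) (h0 : ∀ k, 0 ≤ μ k) (a : ℕ) :
    tailP μ a ≤ 1 := by
  rw [← hμ.tsum_eq]
  apply (hμ.summable.indicator _).tsum_le_tsum _ hμ.summable
  intro k
  exact Set.indicator_le_self' (fun x _ => h0 x) k

theorem stable_case {μ : ℕ → ℝ} (hμ : HasSum μ 1) (h0 : ∀ k, 0 ≤ μ k)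
    (hcrit : HasSum (fun k : ℕ => (k : ℝ) * μ k) 1)
    (hpos : ∀ t, 0 < t → t ≤ Real.pi → 0 < D μ t) {α : ℝ} (hα1 : 1 < α) (hα2 : α < 2)
    {g : ℝ → ℝ} (hg0 : ∀ x : ℝ, 0 < x → 0 < g x)
    (hg : ∀ c : ℝ, 0 < c → Tendsto (fun x => g (c * x) / g x) atTop (nhds 1))
    (htail : ∀ n : ℕ, 1 ≤ n →
      (∑' k : ℕ, {m : ℕ | n ≤ m}.indicator μ k) = g n * (n : ℝ) ^ (-α)) :
    (∃ C : ℝ, ∀ t, 0 ≤ t → t ≤ Real.pi → ‖1 - phi μ t‖ ≤ C * D μ t) ∧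
    (∃ c : ℝ, 0 < c ∧ ∃ γ : ℝ, 1 < γ ∧ ∀ t t', 0 < t → t ≤ t' → t' ≤ Real.pi →
      c * (t' / t) ^ γ * D μ t ≤ D μ t') := by
  have hT : ∀ j : ℕ, tailP μ (2 ^ j) = g (2 ^ j) * ((2 : ℝ) ^ (-α)) ^ j := by
    intro j
    have := htail (2 ^ j) Nat.one_le_two_pow
    unfold tailP
    rw [this]
    push_cast
    rw [← Real.rpow_natCast, ← Real.rpow_natCast, ← Real.rpow_mul (by norm_num),
      ← Real.rpow_mul (by norm_num), mul_comm (j : ℝ)]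
  have hTpos : ∀ j, 0 < tailP μ (2 ^ j) := by
    intro j; rw [hT]
    have := hg0 (2 ^ j) (by positivity)
    positivity
  have hratio : Tendsto (fun j : ℕ => tailP μ (2 ^ (j + 1)) / tailP μ (2 ^ j)) atTop
      (nhds ((2 : ℝ) ^ (-α))) := by
    have h1 := (hg 2 two_pos).comp (tendsto_pow_atTop_atTop_of_one_lt (one_lt_two : (1 : ℝ) < 2))
    have h2 := h1.mul_const ((2 : ℝ) ^ (-α))
    rw [one_mul] at h2
    refine h2.congr fun j => ?_
    rw [hT, hT]
    have := hg0 (2 ^ j) (by positivity)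
    have h3 : (0 : ℝ) < (2 : ℝ) ^ (-α) := by positivity
    simp only [Function.comp]
    rw [pow_succ ((2 : ℝ) ^ (-α)), pow_succ' (2 : ℝ) j]
    field_simp
  set γ := (1 + α) / 2 with hγ
  set β := (α + 2) / 2 with hβ
  set ρ := (2 : ℝ) ^ (-γ) with hρd
  set σ := (2 : ℝ) ^ (-β) with hσd
  have hρ0 : 0 < ρ := by positivity
  have hσ0 : 0 < σ := by positivity
  have hαρ : (2 : ℝ) ^ (-α) < ρ := Real.rpow_lt_rpow_of_exponent_lt one_lt_two (by linarith)
  have hσα : σ < (2 : ℝ) ^ (-α) := Real.rpow_lt_rpow_of_exponent_lt one_lt_two (by linarith)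
  have hρ : 2 * ρ < 1 := by
    have : ρ < (2 : ℝ) ^ (-1 : ℝ) := Real.rpow_lt_rpow_of_exponent_lt one_lt_two (by linarith)
    rw [Real.rpow_neg_one] at this
    linarith
  have hσ : 1 < 4 * σ := by
    have : (2 : ℝ) ^ (-2 : ℝ) < σ := Real.rpow_lt_rpow_of_exponent_lt one_lt_two (by linarith)
    rw [Real.rpow_neg (by norm_num), Real.rpow_two] at this
    linarith
  obtain ⟨J, hJ⟩ := eventually_atTop.mp
    ((hratio.eventually_lt_const hαρ).and (hratio.eventually_const_lt hσα))
  have hJ1 : ∀ j, J ≤ j → tailP μ (2 ^ (j + 1)) ≤ ρ * tailP μ (2 ^ j) := by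
    intro j hj
    have := (hJ j hj).1
    rw [div_lt_iff₀ (hTpos j)] at this
    exact this.le
  have hJ2 : ∀ j, J ≤ j → σ * tailP μ (2 ^ j) ≤ tailP μ (2 ^ (j + 1)) := by
    intro j hj
    have := (hJ j hj).2
    rw [lt_div_iff₀ (hTpos j)] at this
    exact this.le
  obtain ⟨C1, hC1, hC1'⟩ := ev_mono (V := fun j => tailP μ (2 ^ j) / ρ ^ j)
    (fun j => div_pos (hTpos j) (by positivity)) (J := J) (by
      intro j hj
      rw [div_le_div_iff₀ (by positivity) (by positivity), pow_succ ρ]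
      have := hJ1 j hj
      have hp : 0 < ρ ^ j := by positivity
      nlinarith)
  obtain ⟨C2, hC2, hC2'⟩ := ev_mono (V := fun j => σ ^ j / tailP μ (2 ^ j))
    (fun j => div_pos (by positivity) (hTpos j)) (J := J) (by
      intro j hj
      rw [div_le_div_iff₀ (hTpos _) (hTpos _), pow_succ]
      have := hJ2 j hj
      have hp : 0 < σ ^ j := by positivity
      nlinarith)
  set C := max C1 C2 with hC
  have hC0 : 0 < C := lt_max_of_lt_left hC1
  have hup : ∀ j i, tailP μ (2 ^ (j + i)) ≤ C * ρ ^ i * tailP μ (2 ^ j) := by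
    intro j i
    have h1 := hC1' j i
    rw [div_le_iff₀ (by positivity)] at h1
    have := hTpos j
    calc tailP μ (2 ^ (j + i)) ≤ _ := h1
      _ = C1 * ρ ^ i * tailP μ (2 ^ j) := by rw [pow_add]; field_simp
      _ ≤ _ := by gcongr; exact le_max_left _ _
  have hlo : ∀ j i, tailP μ (2 ^ j) * σ ^ i ≤ C * tailP μ (2 ^ (j + i)) := by
    intro j i
    have h1 := hC2' j i
    have h3 := hTpos j
    have h4 := hTpos (j + i)
    rw [div_le_iff₀ h4] at h1
    have hp : 0 < σ ^ j := by positivity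
    calc tailP μ (2 ^ j) * σ ^ i = σ ^ (j + i) * (tailP μ (2 ^ j) / σ ^ j) := by
          rw [pow_add]; field_simp
      _ ≤ (C2 * (σ ^ j / tailP μ (2 ^ j)) * tailP μ (2 ^ (j + i))) *
          (tailP μ (2 ^ j) / σ ^ j) := by gcongr
      _ = C2 * tailP μ (2 ^ (j + i)) := by field_simp
      _ ≤ _ := by gcongr; exact le_max_right _ _
  obtain ⟨K, hK0, hK⟩ := WW_le hμ h0 hC0 hρ0 hρ hσ0 hσ hTpos hup hlo
  have hidx : ∀ t : ℝ, ∃ j : ℕ, 0 < t → t ≤ Real.pi →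
      (1 / 2 : ℝ) ^ (j + 1) < t / 4 ∧ t / 4 ≤ (1 / 2) ^ j := by
    intro t
    by_cases h : 0 < t ∧ t ≤ Real.pi
    · obtain ⟨j, hj⟩ := exists_nat_pow_near_of_lt_one (x := t / 4) (y := (1 / 2 : ℝ))
        (by linarith [h.1]) (by linarith [h.2, Real.pi_le_four]) (by norm_num) (by norm_num)
      exact ⟨j, fun _ _ => hj⟩
    · exact ⟨0, fun h1 h2 => absurd ⟨h1, h2⟩ h⟩
  choose J' hJ' using hidx
  obtain ⟨d, hd0, hd⟩ := D_min hμ h0 hpos (δ := 4 * (1 / 2 : ℝ) ^ (J + 2)) (by positivity)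
  have hpi := Real.pi_pos
  set c := min d (1 / (2 * Real.pi ^ 2) * (1 - ρ)) with hc
  have hc0 : 0 < c := lt_min hd0 (mul_pos (by positivity) (by linarith))
  refine verify hμ h0 hcrit (F := fun t => tailP μ (2 ^ (J' t))) (c := c) (C := K)
    (c' := ρ / C) (γ := γ) hc0 hK0 (by positivity) (by linarith)
    (fun t _ _ => hTpos _) ?_ (fun t ht htp => hK t _ ht (hJ' t ht htp).2) ?_
  · intro t ht htp
    obtain ⟨h1, h2⟩ := hJ' t ht htp
    rcases lt_or_ge (J' t) (J + 2) with h | h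
    · have h3 : (1 / 2 : ℝ) ^ (J + 2) ≤ (1 / 2) ^ (J' t + 1) :=
        pow_le_pow_of_le_one (by norm_num) (by norm_num) (by omega)
      refine le_trans ?_ (hd t (by linarith) htp)
      calc c * tailP μ (2 ^ J' t) ≤ d * 1 := by
            apply mul_le_mul (min_le_left _ _) (tail_le_one hμ h0 _) (hTpos _).le hd0.le
        _ = d := mul_one d
    · obtain ⟨i, hi⟩ := Nat.exists_eq_add_of_le h
      obtain ⟨l, hl⟩ : ∃ l, J' t = l + 2 := ⟨J + i, by omega⟩
      have hlJ : J ≤ l := by omega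
      rw [hl] at h1 h2 ⊢
      refine le_trans ?_ (D_ge_tail hμ h0 l t h1 h2)
      have h3 := hJ1 l hlJ
      have h4 : tailP μ (2 ^ (l + 2)) ≤ tailP μ (2 ^ l) :=
        tail_anti hμ h0 (Nat.pow_le_pow_right (by norm_num) (by omega))
      have h5 := hTpos (l + 2)
      have h6 : 0 < 1 - ρ := by linarith
      calc c * tailP μ (2 ^ (l + 2)) ≤ (1 / (2 * Real.pi ^ 2) * (1 - ρ)) * tailP μ (2 ^ l) := by
            gcongr; exact min_le_right _ _
        _ = 1 / (2 * Real.pi ^ 2) * (tailP μ (2 ^ l) - ρ * tailP μ (2 ^ l)) := by ring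
        _ ≤ _ := by gcongr
  · intro t t' ht htt' htp'
    have ht' := ht.trans_le htt'
    obtain ⟨h1, h2⟩ := hJ' t ht (htt'.trans htp')
    obtain ⟨h3, h4⟩ := hJ' t' ht' htp'
    have h5 : J' t' ≤ J' t := by
      by_contra! hlt
      have : (1 / 2 : ℝ) ^ (J' t') ≤ (1 / 2) ^ (J' t + 1) :=
        pow_le_pow_of_le_one (by norm_num) (by norm_num) (by omega)
      linarith
    obtain ⟨l, hl⟩ := Nat.exists_eq_add_of_le h5
    rw [hl] at h1 h2 ⊢
    have h6 : t' / t ≤ 2 ^ (l + 1) := by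
      rw [div_le_iff₀ ht]
      have e : (2 : ℝ) ^ (l + 1) * (1 / 2) ^ (l + 1) = 1 := by rw [← mul_pow]; norm_num
      have h7 : (1 / 2 : ℝ) ^ (J' t') = 2 ^ (l + 1) * (1 / 2) ^ (J' t' + l + 1) := by
        rw [add_assoc, pow_add]
        linear_combination (-(1 / 2 : ℝ) ^ (J' t')) * e
      have h8 : (2 : ℝ) ^ (l + 1) * (1 / 2) ^ (J' t' + l + 1) ≤ 2 ^ (l + 1) * (t / 4) := by gcongr
      linarith
    have h9 : (t' / t) ^ γ * ρ ^ (l + 1) ≤ 1 := by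
      have e : ((2 : ℝ) ^ (l + 1)) ^ γ * ρ ^ (l + 1) = 1 := by
        rw [hρd, Real.rpow_neg (by norm_num), inv_pow, ← Real.rpow_natCast, ← Real.rpow_natCast,
          ← Real.rpow_mul (by norm_num), ← Real.rpow_mul (by norm_num), mul_comm γ]
        exact mul_inv_cancel₀ (by positivity)
      rw [← e]
      gcongr
    have h10 := hup (J' t') l
    have hr : 0 < (t' / t) ^ γ := by positivity
    have h11 := hTpos (J' t')
    calc ρ / C * (t' / t) ^ γ * tailP μ (2 ^ (J' t' + l))
        ≤ ρ / C * (t' / t) ^ γ * (C * ρ ^ l * tailP μ (2 ^ J' t')) := by gcongr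
      _ = ((t' / t) ^ γ * ρ ^ (l + 1)) * tailP μ (2 ^ J' t') := by rw [pow_succ]; field_simp
      _ ≤ 1 * tailP μ (2 ^ J' t') := by gcongr
      _ = _ := one_mul _

end PlaneTree

namespace PlaneTree

theorem abs_lim {w : ℕ → ℝ} {m0 C : ℝ} (hw0 : ∀ k, 0 ≤ w k) (hw : HasSum w m0) (hm0 : 0 < m0)
    {x : ℕ → ℕ → ℝ} (hx0 : ∀ᶠ n in atTop, ∀ k, 0 ≤ x n k ∧ x n k ≤ C)
    (hx1 : ∀ k, Tendsto (fun n => x n k) atTop (nhds 1)) :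
    ∀ ε : ℝ, 0 < ε → ∀ᶠ n : ℕ in atTop, ∀ k,
      |w k * x n k / (∑' j, w j * x n j) - w k / m0| < ε := by
  have hS : Tendsto (fun n => ∑' j, w j * x n j) atTop (nhds m0) := by
    have h := tendsto_tsum_of_dominated_convergence (𝓕 := atTop)
      (f := fun n j => w j * x n j) (g := w) (bound := fun j => w j * C)
      (hw.summable.mul_right C) (fun k => by simpa using (hx1 k).const_mul (w k)) (by
        filter_upwards [hx0] with n hn k
        rw [Real.norm_of_nonneg (mul_nonneg (hw0 k) (hn k).1)]
        exact mul_le_mul_of_nonneg_left (hn k).2 (hw0 k))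
    rwa [hw.tsum_eq] at h
  have hE : Tendsto (fun n => ∑' j, w j * |x n j - 1|) atTop (nhds 0) := by
    have h := tendsto_tsum_of_dominated_convergence (𝓕 := atTop)
      (f := fun n j => w j * |x n j - 1|) (g := fun _ => 0) (bound := fun j => w j * (C + 1))
      (hw.summable.mul_right (C + 1)) (fun k => by
        have h1 := (((hx1 k).sub_const 1).abs).const_mul (w k)
        simpa using h1) (by
        filter_upwards [hx0] with n hn k
        rw [Real.norm_of_nonneg (mul_nonneg (hw0 k) (abs_nonneg _))]
        refine mul_le_mul_of_nonneg_left ?_ (hw0 k)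
        rw [abs_le]
        constructor <;> linarith [(hn k).1, (hn k).2])
    simpa using h
  have hinv : Tendsto (fun n => |(∑' j, w j * x n j)⁻¹ - m0⁻¹|) atTop (nhds 0) := by
    simpa using ((hS.inv₀ hm0.ne').sub_const m0⁻¹).abs
  have hlim : Tendsto (fun n => (∑' j, w j * |x n j - 1|) * (∑' j, w j * x n j)⁻¹ +
      m0 * |(∑' j, w j * x n j)⁻¹ - m0⁻¹|) atTop (nhds 0) := by
    simpa using (hE.mul (hS.inv₀ hm0.ne')).add (hinv.const_mul m0)
  intro ε hε
  filter_upwards [hx0, hS.eventually_const_lt hm0, hlim.eventually_lt_const hε] with n hn hSn hl k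
  refine lt_of_le_of_lt ?_ hl
  set S := ∑' j, w j * x n j
  have hsum : Summable fun j => w j * |x n j - 1| := by
    apply Summable.of_nonneg_of_le _ _ (hw.summable.mul_right (C + 1))
    · exact fun k => mul_nonneg (hw0 k) (abs_nonneg _)
    · intro k
      refine mul_le_mul_of_nonneg_left ?_ (hw0 k)
      rw [abs_le]
      constructor <;> linarith [(hn k).1, (hn k).2]
  have h1 : w k * |x n k - 1| ≤ ∑' j, w j * |x n j - 1| :=
    hsum.le_tsum k fun j _ => mul_nonneg (hw0 j) (abs_nonneg _)
  have h2 : w k ≤ m0 := by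
    rw [← hw.tsum_eq]; exact hw.summable.le_tsum k fun j _ => hw0 j
  have e : w k * x n k / S - w k / m0 =
      w k * (x n k - 1) * S⁻¹ + w k * (S⁻¹ - m0⁻¹) := by
    rw [div_eq_mul_inv, div_eq_mul_inv]; ring
  rw [e]
  refine (abs_add_le _ _).trans ?_
  rw [abs_mul, abs_mul, abs_mul, abs_of_nonneg (hw0 k), abs_of_pos (inv_pos.mpr hSn)]
  gcongr

theorem final_main (μ0 μ : ℕ → ℝ) (m0 α : ℝ)
    (hμ0nn : ∀ k, 0 ≤ μ0 k) (hμ00 : μ0 0 = 0) (hμ0sum : HasSum μ0 1)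
    (hμ0mean : HasSum (fun k : ℕ => (k : ℝ) * μ0 k) m0)
    (hμnn : ∀ k, 0 ≤ μ k) (hμsum : HasSum μ 1)
    (hμpos : 0 < μ 0)
    (hcrit : HasSum (fun k : ℕ => (k : ℝ) * μ k) 1)
    (haper : ∀ d : ℕ, (∀ i : ℕ, 0 < i → 0 < μ i → d ∣ i) → d = 1)
    (hα1 : 1 < α) (hdom : DomAttr μ α) :
    ∀ ε : ℝ, 0 < ε → ∀ᶠ n : ℕ in atTop, ∀ k : ℕ, 1 ≤ k →
      |(∑ᶠ τ ∈ {τ : PlaneTree | τ.verts.card = n ∧ τ.kc [] = k}, bgwModW μ0 μ τ) /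
          bgwModMass μ0 μ n - (k : ℝ) * μ0 k / m0| < ε := by
  have hpos := D_pos hμsum hμnn haper
  obtain ⟨hA, hB⟩ : (∃ C : ℝ, ∀ t, 0 ≤ t → t ≤ Real.pi → ‖1 - phi μ t‖ ≤ C * D μ t) ∧
      (∃ c : ℝ, 0 < c ∧ ∃ γ : ℝ, 1 < γ ∧ ∀ t t', 0 < t → t ≤ t' → t' ≤ Real.pi →
      c * (t' / t) ^ γ * D μ t ≤ D μ t') := by
    rcases hdom with ⟨_, hv⟩ | ⟨hα2, g, hg0, hg, ht⟩
    · exact finvar hμsum hμnn hcrit hpos hv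
    · exact stable_case hμsum hμnn hcrit hpos hα1 hα2 hg0 hg ht
  obtain ⟨⟨C, hC⟩, hlim⟩ := core hμsum hμnn hμpos hpos hA hB
  have hw0 : ∀ k : ℕ, 0 ≤ (k : ℝ) * μ0 k := fun k => mul_nonneg (by positivity) (hμ0nn k)
  have hm0 : 0 < m0 := by
    have : (1 : ℝ) ≤ m0 := by
      refine hasSum_le (fun k => ?_) hμ0sum hμ0mean
      rcases Nat.eq_zero_or_pos k with h | h
      · simp [h, hμ00]
      · have : (1 : ℝ) ≤ k := by exact_mod_cast h
        nlinarith [hμ0nn k]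
    linarith
  have hqnn : ∀ n k, 0 ≤ q μ n k := by
    intro n k
    unfold q
    split_ifs
    · exact pw_nonneg hμnn _ _
    · exact le_rfl
  intro ε hε
  have hmain := abs_lim hw0 hμ0mean hm0 (C := C) (x := fun n k => q μ n k / q μ n 0) (by
    filter_upwards [hC] with n hn k
    refine ⟨div_nonneg (hqnn n k) hn.1.le, ?_⟩
    rw [div_le_iff₀ hn.1]
    exact hn.2 k) hlim ε hε
  obtain ⟨N, hN⟩ := eventually_atTop.mp (hmain.and hC)
  refine eventually_atTop.mpr ⟨N + 2, fun n hn k _ => ?_⟩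
  obtain ⟨m, rfl⟩ : ∃ m, n = m + 1 + 1 := ⟨n - 2, by omega⟩
  obtain ⟨h1, h2, _⟩ := hN (m + 1) (by omega)
  have h3 := h1 k
  rw [finsum_Tk, mass_eq]
  have hm : (0 : ℝ) < (m : ℝ) + 1 := by positivity
  have hAq : ∀ j : ℕ, μ0 j * A μ j (m + 1 + 1) =
      (q μ (m + 1) 0 / ((m : ℝ) + 1)) * ((j : ℝ) * μ0 j * (q μ (m + 1) j / q μ (m + 1) 0)) := by
    intro j
    have h4 := A_eq_q μ m j
    have h5 : A μ j (m + 1 + 1) = j * q μ (m + 1) j / ((m : ℝ) + 1) := by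
      rw [eq_div_iff hm.ne']; linarith
    rw [h5]
    field_simp
  have htsum : ∑' j : ℕ, (j : ℝ) * μ0 j * (q μ (m + 1) j / q μ (m + 1) 0) =
      ∑ j ∈ Finset.range (m + 1 + 1), (j : ℝ) * μ0 j * (q μ (m + 1) j / q μ (m + 1) 0) := by
    apply tsum_eq_sum
    intro j hj
    rw [Finset.mem_range] at hj
    have : q μ (m + 1) j = 0 := by
      unfold q; rw [if_neg (by omega)]
    rw [this]; simp
  simp only [hAq]
  rw [← Finset.mul_sum, ← htsum, mul_div_mul_left _ _ (by positivity)]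
  exact h3

end PlaneTree

/-- Let `μ_∅` be a probability measure on `{1,2,…}` with finite mean `m₀`
and `μ` a critical aperiodic probability measure on `ℤ₊` in the domain of attraction of a
stable law of index `α ∈ (1,2]`. Then the law of the number of children `N₀` of the root
under `BGW_n^{μ_∅,μ}` converges, uniformly in `k`, to the size-biased law
`k μ_∅(k)/Σ_j j μ_∅(j)`. -/
theorem root_degree_law_uniform_convergence (μ0 μ : ℕ → ℝ) (m0 α : ℝ)
    (hμ0nn : ∀ k, 0 ≤ μ0 k) (hμ00 : μ0 0 = 0) (hμ0sum : HasSum μ0 1)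
    (hμ0mean : HasSum (fun k : ℕ => (k : ℝ) * μ0 k) m0)
    (hμnn : ∀ k, 0 ≤ μ k) (hμsum : HasSum μ 1)
    (hμpos : 0 < μ 0) (hμ01 : μ 0 + μ 1 < 1)
    (hcrit : HasSum (fun k : ℕ => (k : ℝ) * μ k) 1)
    (haper : ∀ d : ℕ, (∀ i : ℕ, 0 < i → 0 < μ i → d ∣ i) → d = 1)
    (hα1 : 1 < α) (hα2 : α ≤ 2) (hdom : DomAttr μ α) :
    ∀ ε : ℝ, 0 < ε → ∀ᶠ n : ℕ in atTop, ∀ k : ℕ, 1 ≤ k →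
      |(∑ᶠ τ ∈ {τ : PlaneTree | τ.verts.card = n ∧ τ.kc [] = k}, bgwModW μ0 μ τ) /
          bgwModMass μ0 μ n - (k : ℝ) * μ0 k / m0| < ε := by
  exact PlaneTree.final_main μ0 μ m0 α hμ0nn hμ00 hμ0sum hμ0mean hμnn hμsum hμpos hcrit haper
    hα1 hdom

end
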